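/- In the penalized-bias model-selection setup with a finite nonempty collection 𝓜 of cut-offs satisfying (2·max 𝓜 + 1)^d ≤ n, and with a bounded probability density f on [0,1]^d, there exist absolute constants C₁ > 0 and C₃ > 0 and a constant C₂ > 0 depending only on ‖f‖_∞ such that E(‖f − f̂_{M̂}‖²) ≤ C₁ · min_{M ∈ 𝓜} ( ‖f − f_M‖² + (2M+1)^d / n + 2·(2M+1)^d·σ_M² ) + C₂ / n + C₃·|𝓜| / (n²·ρ), where ‖·‖ is the L²([0,1]^d) norm. -/

import Mathlib

open MeasureTheory ProbabilityTheory Real Complex Finset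

noncomputable section

def cube (d : ℕ) : Set (Fin d → ℝ) := Set.Icc 0 1

def phi (d : ℕ) (k : Fin d → ℤ) (x : Fin d → ℝ) : ℂ :=
  Complex.exp (Complex.I * (2 * Real.pi) * ∑ i, (k i : ℂ) * (x i : ℂ))

def fCoeff (d : ℕ) (g : (Fin d → ℝ) → ℂ) (k : Fin d → ℤ) : ℂ :=
  ∫ x in cube d, g x * (starRingEnd ℂ) (phi d k x)

def box (d M : ℕ) : Finset (Fin d → ℤ) :=
  Fintype.piFinset fun _ => Finset.Icc (-(M : ℤ)) (M : ℤ)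

def projM (d M : ℕ) (g : (Fin d → ℝ) → ℂ) : (Fin d → ℝ) → ℂ :=
  fun x => ∑ k ∈ box d M, fCoeff d g k * phi d k x

def l2sq (d : ℕ) (g : (Fin d → ℝ) → ℂ) : ℝ :=
  ∫ x in cube d, ‖g x‖ ^ 2

def densMeasure (d : ℕ) (f : (Fin d → ℝ) → ℝ) : Measure (Fin d → ℝ) :=
  (volume.restrict (cube d)).withDensity fun x => ENNReal.ofReal (f x)

def IsDensity (d : ℕ) (f : (Fin d → ℝ) → ℝ) : Prop :=
  Measurable f ∧ (∀ x ∈ cube d, 0 ≤ f x) ∧ (∫ x in cube d, f x) = 1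

def stdCGauss : Measure ℂ :=
  ((gaussianReal 0 1).prod (gaussianReal 0 1)).map fun p => (p.1 : ℂ) + (p.2 : ℂ) * Complex.I

def empCoeff (d n : ℕ) (X : Fin n → (Fin d → ℝ)) (k : Fin d → ℤ) : ℂ :=
  (n : ℂ)⁻¹ * ∑ j, (starRingEnd ℂ) (phi d k (X j))

abbrev SampleSpace (d n M : ℕ) : Type :=
  (Fin n → (Fin d → ℝ)) × ((Fin d → Fin (2 * M + 1)) → ℂ)

def sampleMeasure (d n M : ℕ) (f : (Fin d → ℝ) → ℝ) : Measure (SampleSpace d n M) :=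
  (Measure.pi fun _ => densMeasure d f).prod (Measure.pi fun _ => stdCGauss)

def toIdx (d M : ℕ) (ν : Fin d → Fin (2 * M + 1)) : Fin d → ℤ :=
  fun i => (ν i : ℤ) - M

def privEst (d n M : ℕ) (σ : ℝ) (ω : SampleSpace d n M) : (Fin d → ℝ) → ℂ :=
  fun x => ∑ ν : Fin d → Fin (2 * M + 1),
    (empCoeff d n ω.1 (toIdx d M ν) + (σ : ℂ) * ω.2 ν) * phi d (toIdx d M ν) x

/-- Sample space for model selection: data plus a fresh array of complex Gaussian
noises for each cut-off `M ∈ 𝓜`. -/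
abbrev SelSpace (d n : ℕ) (𝓜 : Finset ℕ) : Type :=
  (Fin n → (Fin d → ℝ)) × ((M : 𝓜) → (Fin d → Fin (2 * (M : ℕ) + 1)) → ℂ)

/-- Law of the data (i.i.d. with density `f`) and of the independent Gaussian noises. -/
def selMeasure (d n : ℕ) (𝓜 : Finset ℕ) (f : (Fin d → ℝ) → ℝ) :
    Measure (SelSpace d n 𝓜) :=
  (Measure.pi fun _ => densMeasure d f).prod
    (Measure.pi fun _ => Measure.pi fun _ => stdCGauss)

/-- The noise scale `σ_M = 2 √((2M+1)^d) / (n √(ρ/|𝓜|))`. -/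
def sigmaSel (d n : ℕ) (𝓜 : Finset ℕ) (ρ : ℝ) (M : ℕ) : ℝ :=
  2 * Real.sqrt (((2 * M + 1 : ℕ) : ℝ) ^ d) / ((n : ℝ) * Real.sqrt (ρ / 𝓜.card))

/-- The private projection estimator `f̂_M` for a cut-off `M ∈ 𝓜`. -/
def selEst (d n : ℕ) (𝓜 : Finset ℕ) (ρ : ℝ) (M : 𝓜) (ω : SelSpace d n 𝓜) :
    (Fin d → ℝ) → ℂ :=
  fun x => ∑ ν : Fin d → Fin (2 * (M : ℕ) + 1),
    (empCoeff d n ω.1 (toIdx d M ν) + (sigmaSel d n 𝓜 ρ M : ℂ) * ω.2 M ν) *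
      phi d (toIdx d M ν) x

/-- `f̂_M` for a natural-number cut-off `M` (junk value `0` if `M ∉ 𝓜`). -/
def selEstN (d n : ℕ) (𝓜 : Finset ℕ) (ρ : ℝ) (M : ℕ) (ω : SelSpace d n 𝓜) :
    (Fin d → ℝ) → ℂ :=
  if h : M ∈ 𝓜 then selEst d n 𝓜 ρ ⟨M, h⟩ ω else 0

/-- Penalty `Λ⁽¹⁾(M) = 96 (2M+1)^d / n + 96 (2M+1)^{2d} / (n² ρ / |𝓜|)`. -/
def lam1 (d n : ℕ) (𝓜 : Finset ℕ) (ρ : ℝ) (M : ℕ) : ℝ :=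
  96 * ((2 * M + 1 : ℕ) : ℝ) ^ d / n +
    96 * ((2 * M + 1 : ℕ) : ℝ) ^ (2 * d) / ((n : ℝ) ^ 2 * (ρ / 𝓜.card))

/-- Penalty `Λ⁽²⁾(M) = Λ⁽¹⁾(M) + 16 (2M+1)^{2d} / (n² ρ / |𝓜|)`. -/
def lam2 (d n : ℕ) (𝓜 : Finset ℕ) (ρ : ℝ) (M : ℕ) : ℝ :=
  lam1 d n 𝓜 ρ M +
    16 * ((2 * M + 1 : ℕ) : ℝ) ^ (2 * d) / ((n : ℝ) ^ 2 * (ρ / 𝓜.card))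

/-- Estimated squared bias
`B²(M) = max_{M' ∈ 𝓜} (‖proj_{S_{M'}}(f̂_M) - f̂_{M'}‖² - Λ⁽¹⁾(M'))`. -/
def Bsq (d n : ℕ) (𝓜 : Finset ℕ) (ρ : ℝ) (M : ℕ) (ω : SelSpace d n 𝓜) : ℝ :=
  sSup ((fun M' : ℕ =>
    l2sq d (fun x => projM d M' (selEstN d n 𝓜 ρ M ω) x - selEstN d n 𝓜 ρ M' ω x)
      - lam1 d n 𝓜 ρ M') '' ↑𝓜)

/-- `Msel` is a measurable argmin of `M ↦ B²(M) + Λ⁽²⁾(M)` over `𝓜`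
(ties broken arbitrarily but measurably). -/
def IsSelectionRule (d n : ℕ) (𝓜 : Finset ℕ) (ρ : ℝ)
    (Msel : SelSpace d n 𝓜 → ℕ) : Prop :=
  Measurable Msel ∧ ∀ ω, Msel ω ∈ 𝓜 ∧ ∀ M ∈ 𝓜,
    Bsq d n 𝓜 ρ (Msel ω) ω + lam2 d n 𝓜 ρ (Msel ω)
      ≤ Bsq d n 𝓜 ρ M ω + lam2 d n 𝓜 ρ M

/-- Essential supremum norm `‖f‖_∞` of `f` on `[0,1]^d`. -/
def supNorm (d : ℕ) (f : (Fin d → ℝ) → ℝ) : ℝ :=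
  (eLpNorm (fun x => f x) ⊤ (volume.restrict (cube d))).toReal

set_option linter.unusedSectionVars false

section Moments

variable {E V : Type*} [MeasurableSpace E] [NormedAddCommGroup V] [InnerProductSpace ℝ V]

/-- `Y` is measurable, centered, bounded by `√B`, and has weak variance at most `v`. -/
structure WeakVarBound [MeasurableSpace V] (μ : Measure E) (Y : E → V) (B v : ℝ) : Prop where
  meas : Measurable Y
  bound : ∀ x, ‖Y x‖ ^ 2 ≤ B
  centered : ∀ u : V, ∫ x, inner ℝ u (Y x) ∂μ = 0
  weakVar : ∀ u : V, ∫ x, inner ℝ u (Y x) ^ 2 ∂μ ≤ v * ‖u‖ ^ 2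

def vecSum (Y : E → V) (n : ℕ) (X : Fin n → E) : V := ∑ i, Y (X i)

/-- The off-diagonal part of `‖∑ Y (X i)‖²`. -/
def offDiagSum (Y : E → V) (n : ℕ) (X : Fin n → E) : ℝ :=
  ‖vecSum Y n X‖ ^ 2 - ∑ i, ‖Y (X i)‖ ^ 2

lemma vecSum_cons (Y : E → V) (n : ℕ) (x : E) (X : Fin n → E) :
    vecSum Y (n + 1) (Fin.cons x X) = vecSum Y n X + Y x := by
  simp [vecSum, Fin.sum_univ_succ, add_comm]

lemma offDiag_cons (Y : E → V) (n : ℕ) (x : E) (X : Fin n → E) :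
    offDiagSum Y (n + 1) (Fin.cons x X) = offDiagSum Y n X + 2 * inner ℝ (vecSum Y n X) (Y x) := by
  unfold offDiagSum
  rw [vecSum_cons, norm_add_sq_real, Fin.sum_univ_succ]
  simp
  ring

lemma integrable_of_abs_le {α : Type*} [MeasurableSpace α] {μ : Measure α} [IsFiniteMeasure μ]
    {g : α → ℝ} (hg : Measurable g) (C : ℝ) (hC : ∀ x, |g x| ≤ C) : Integrable g μ :=
  Integrable.of_bound hg.aestronglyMeasurable C (.of_forall hC)

lemma integral_pi_fin_succ (μ : Measure E) [IsProbabilityMeasure μ] (n : ℕ)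
    (F : (Fin (n + 1) → E) → ℝ) (hF : Integrable F (Measure.pi fun _ => μ)) :
    ∫ X, F X ∂(Measure.pi fun _ => μ) =
      ∫ X, ∫ x, F (Fin.cons x X) ∂μ ∂(Measure.pi fun _ : Fin n => μ) := by
  have h := (measurePreserving_piFinSuccAbove (fun _ : Fin (n + 1) => μ) 0).symm
  rw [← h.integral_comp']
  have h2 := (h.integrable_comp_emb (MeasurableEquiv.measurableEmbedding _)).2 hF
  rw [integral_prod_symm]
  · simp [MeasurableEquiv.piFinSuccAbove_symm_apply, Fin.insertNthEquiv]
  · exact h2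

variable [MeasurableSpace V] [BorelSpace V] [SecondCountableTopology V]
variable {μ : Measure E} [IsProbabilityMeasure μ] {Y : E → V} {B v : ℝ}

namespace WeakVarBound

lemma norm_le (h : WeakVarBound μ Y B v) (x : E) : ‖Y x‖ ≤ √B :=
  Real.le_sqrt_of_sq_le (h.bound x)

lemma measurable_vecSum (h : WeakVarBound μ Y B v) (n : ℕ) : Measurable (vecSum Y n) := by
  have := h.meas
  unfold vecSum
  fun_prop

lemma measurable_offDiag (h : WeakVarBound μ Y B v) (n : ℕ) : Measurable (offDiagSum Y n) := by
  have := h.meas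
  have := h.measurable_vecSum n
  unfold offDiagSum
  fun_prop

lemma norm_vecSum_le (h : WeakVarBound μ Y B v) (n : ℕ) (X : Fin n → E) :
    ‖vecSum Y n X‖ ≤ n * √B := by
  refine (norm_sum_le _ _).trans ?_
  refine (Finset.sum_le_sum fun i _ => h.norm_le (X i)).trans ?_
  simp

lemma sum_sq_le (h : WeakVarBound μ Y B v) (n : ℕ) (X : Fin n → E) :
    ∑ i, ‖Y (X i)‖ ^ 2 ≤ n * B := by
  refine (Finset.sum_le_sum fun i _ => h.bound (X i)).trans ?_
  simp

lemma sq_norm_le_offDiag (h : WeakVarBound μ Y B v) (n : ℕ) (X : Fin n → E) :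
    ‖vecSum Y n X‖ ^ 2 ≤ offDiagSum Y n X + n * B := by
  have := h.sum_sq_le n X
  unfold offDiagSum
  linarith

lemma abs_offDiag_le (h : WeakVarBound μ Y B v) (n : ℕ) (X : Fin n → E) :
    |offDiagSum Y n X| ≤ (n * √B) ^ 2 + n * B := by
  have h1 := h.sum_sq_le n X
  have h2 := pow_le_pow_left₀ (norm_nonneg _) (h.norm_vecSum_le n X) 2
  have h3 : 0 ≤ ∑ i, ‖Y (X i)‖ ^ 2 := by positivity
  have h4 : 0 ≤ ‖vecSum Y n X‖ ^ 2 := by positivity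
  unfold offDiagSum
  rw [abs_le]
  constructor <;> nlinarith

lemma integrable_offDiag_pow (h : WeakVarBound μ Y B v) (n p : ℕ) :
    Integrable (fun X => offDiagSum Y n X ^ p) (Measure.pi fun _ => μ) :=
  integrable_of_abs_le ((h.measurable_offDiag n).pow_const p) (((n * √B) ^ 2 + n * B) ^ p)
    fun X => by
      rw [abs_pow]
      exact pow_le_pow_left₀ (abs_nonneg _) (h.abs_offDiag_le n X) p

lemma integrable_sq_norm_vecSum (h : WeakVarBound μ Y B v) (n : ℕ) :
    Integrable (fun X => ‖vecSum Y n X‖ ^ 2) (Measure.pi fun _ => μ) :=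
  integrable_of_abs_le ((h.measurable_vecSum n).norm.pow_const 2) ((n * √B) ^ 2)
    fun X => by
      rw [abs_pow, abs_norm]
      exact pow_le_pow_left₀ (norm_nonneg _) (h.norm_vecSum_le n X) 2

lemma abs_inner_le (h : WeakVarBound μ Y B v) (u : V) (x : E) :
    |inner ℝ u (Y x)| ≤ ‖u‖ * √B :=
  (abs_real_inner_le_norm _ _).trans (by gcongr; exact h.norm_le x)

lemma integrable_inner_pow (h : WeakVarBound μ Y B v) (u : V) (p : ℕ) :
    Integrable (fun x => inner ℝ u (Y x) ^ p) μ := by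
  refine integrable_of_abs_le ?_ ((‖u‖ * √B) ^ p) fun x => ?_
  · have := h.meas
    fun_prop
  · rw [abs_pow]
    exact pow_le_pow_left₀ (abs_nonneg _) (h.abs_inner_le u x) p

/-- Integrate an affine function of the first two powers of `⟪u, Y⟫`. -/
lemma integral_quadratic_le (h : WeakVarBound μ Y B v) (u : V) (a b : ℝ) {c : ℝ} (hc : 0 ≤ c) :
    Integrable (fun x => a + b * inner ℝ u (Y x) + c * inner ℝ u (Y x) ^ 2) μ ∧
    ∫ x, (a + b * inner ℝ u (Y x) + c * inner ℝ u (Y x) ^ 2) ∂μ ≤ a + c * (v * ‖u‖ ^ 2) := by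
  have i1 : Integrable (fun x => inner ℝ u (Y x)) μ := by
    simpa using h.integrable_inner_pow u 1
  have i2 := h.integrable_inner_pow u 2
  have i3 : Integrable (fun x => a + b * inner ℝ u (Y x)) μ :=
    (integrable_const a).add (i1.const_mul b)
  refine ⟨i3.add (i2.const_mul c), ?_⟩
  rw [integral_add i3 (i2.const_mul c),
    integral_add (integrable_const a) (i1.const_mul b), integral_const_mul, integral_const_mul,
    h.centered u]
  have := mul_le_mul_of_nonneg_left (h.weakVar u) hc
  simpa using this

lemma integral_sq_norm_vecSum_le (h : WeakVarBound μ Y B v) (n : ℕ) :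
    ∫ X, ‖vecSum Y n X‖ ^ 2 ∂(Measure.pi fun _ => μ) ≤ n * B := by
  induction n with
  | zero => simp [vecSum]
  | succ n ih =>
    rw [integral_pi_fin_succ μ n _ (h.integrable_sq_norm_vecSum (n + 1))]
    calc _ ≤ ∫ X, (‖vecSum Y n X‖ ^ 2 + B) ∂(Measure.pi fun _ => μ) := by
            refine integral_mono_of_nonneg (.of_forall fun X => ?_)
              ((h.integrable_sq_norm_vecSum n).add (integrable_const B)) (.of_forall fun X => ?_)
            · exact integral_nonneg fun x => by positivity
            · obtain ⟨i, hi⟩ := h.integral_quadratic_le (vecSum Y n X)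
                (‖vecSum Y n X‖ ^ 2 + B) 2 le_rfl
              refine (integral_mono_of_nonneg (.of_forall fun x => by positivity) i
                (.of_forall fun x => ?_)).trans (hi.trans (by simp))
              simp only [vecSum_cons, norm_add_sq_real]
              linarith [h.bound x]
      _ ≤ _ := by
            rw [integral_add (h.integrable_sq_norm_vecSum n) (integrable_const B)]
            simp
            linarith

lemma integral_offDiag_sq_le (h : WeakVarBound μ Y B v) (hv : 0 ≤ v) (N n : ℕ) (hn : n ≤ N) :
    ∫ X, offDiagSum Y n X ^ 2 ∂(Measure.pi fun _ => μ) ≤ 4 * v * B * N * n := by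
  induction n with
  | zero => simp [vecSum, offDiagSum]
  | succ n ih =>
    have ih := ih (by omega)
    rw [integral_pi_fin_succ μ n _ (h.integrable_offDiag_pow (n + 1) 2)]
    have hB : 0 ≤ n * B :=
      (integral_nonneg fun x => by positivity).trans (h.integral_sq_norm_vecSum_le n)
    have hnN : (n : ℝ) + 1 ≤ N := by exact_mod_cast hn
    calc _ ≤ ∫ X, (offDiagSum Y n X ^ 2 + 4 * v * ‖vecSum Y n X‖ ^ 2) ∂(Measure.pi fun _ => μ) := by
            refine integral_mono_of_nonneg (.of_forall fun X => ?_)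
              ((h.integrable_offDiag_pow n 2).add
                ((h.integrable_sq_norm_vecSum n).const_mul (4 * v))) (.of_forall fun X => ?_)
            · exact integral_nonneg fun x => by positivity
            · obtain ⟨i, hi⟩ := h.integral_quadratic_le (vecSum Y n X)
                (offDiagSum Y n X ^ 2) (4 * offDiagSum Y n X) (c := 4) (by norm_num)
              refine (integral_mono_of_nonneg (.of_forall fun x => by positivity) i
                (.of_forall fun x => ?_)).trans (hi.trans (by linarith))
              simp only [offDiag_cons]
              apply le_of_eq
              ring
      _ ≤ _ := by
            rw [integral_add (h.integrable_offDiag_pow n 2)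
              ((h.integrable_sq_norm_vecSum n).const_mul (4 * v)), integral_const_mul]
            have h1 := mul_le_mul_of_nonneg_left (h.integral_sq_norm_vecSum_le n)
              (by positivity : 0 ≤ 4 * v)
            have hB' : 0 ≤ B := by
              obtain ⟨x⟩ : Nonempty E := nonempty_of_isProbabilityMeasure μ
              exact (sq_nonneg _).trans (h.bound x)
            have h2 : v * B * n ≤ v * B * N := by gcongr; linarith
            push_cast
            nlinarith

lemma cons_pow_four_le {t e s B : ℝ} (he : e ^ 2 ≤ s * B) :
    (t + 2 * e) ^ 4 ≤ t ^ 4 + 8 * t ^ 3 * e + (32 * t ^ 2 + 48 * s * B) * e ^ 2 := by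
  have h1 : e ^ 4 ≤ s * B * e ^ 2 := by nlinarith [sq_nonneg e]
  nlinarith [sq_nonneg (t * e - 2 * e ^ 2)]

lemma quartic_step {t s B v N m : ℝ} (hs0 : 0 ≤ s) (hs : s ≤ t + m * B) (hmN : m ≤ N)
    (hN : 0 < N) (hB : 0 ≤ B) (hv : 0 ≤ v) :
    t ^ 4 + (32 * t ^ 2 + 48 * s * B) * (v * s) ≤
      (1 + 1 / N) * t ^ 4 + (256 * v ^ 2 * N + 32 * v * B * N + 96 * B * v) * t ^ 2
        + 96 * v * B ^ 3 * N ^ 2 := by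
  have hs1 : s ≤ |t| + N * B := hs.trans (by gcongr; exact le_abs_self t)
  have e2 : s ^ 2 ≤ 2 * t ^ 2 + 2 * (N * B) ^ 2 := by
    have := pow_le_pow_left₀ hs0 hs1 2
    have h3 : |t| ^ 2 = t ^ 2 := sq_abs t
    nlinarith [sq_nonneg (|t| - N * B)]
  have e1 : t ^ 2 * s ≤ t ^ 2 * |t| + t ^ 2 * (N * B) := by
    rw [← mul_add]; gcongr
  have e3 : 32 * v * (t ^ 2 * |t|) ≤ 1 / N * t ^ 4 + 256 * v ^ 2 * N * t ^ 2 := by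
    have h5 : 1 / N * t ^ 4 + 256 * v ^ 2 * N * t ^ 2 - 32 * v * (t ^ 2 * |t|)
        = t ^ 2 * (1 / N) * (|t| - 16 * v * N) ^ 2 := by
      have h3 : |t| ^ 2 = t ^ 2 := sq_abs t
      field_simp
      linear_combination (-t ^ 2) * h3
    have : 0 ≤ t ^ 2 * (1 / N) * (|t| - 16 * v * N) ^ 2 := by positivity
    linarith
  have f1 := mul_le_mul_of_nonneg_left e1 (by positivity : 0 ≤ 32 * v)
  have f2 := mul_le_mul_of_nonneg_left e2 (by positivity : 0 ≤ 48 * B * v)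
  nlinarith

lemma integral_offDiag_pow_four_step (h : WeakVarBound μ Y B v) (hv : 1 ≤ v) (N n : ℕ)
    (hn : n < N) (hB1 : 1 ≤ B) (hBN : B ≤ 4 * N) :
    ∫ X, offDiagSum Y (n + 1) X ^ 4 ∂(Measure.pi fun _ => μ) ≤
      (1 + 1 / (N : ℝ)) * ∫ X, offDiagSum Y n X ^ 4 ∂(Measure.pi fun _ => μ)
        + 2000 * v ^ 3 * B ^ 2 * N ^ 3 := by
  have hnN : (n : ℝ) ≤ N := by exact_mod_cast hn.le
  have hN : (1 : ℝ) ≤ N := by exact_mod_cast (by omega : 1 ≤ N)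
  rw [integral_pi_fin_succ μ n _ (h.integrable_offDiag_pow (n + 1) 4)]
  set K := 256 * v ^ 2 * N + 32 * v * B * N + 96 * B * v with hK
  have i4 := (h.integrable_offDiag_pow n 4).const_mul (1 + 1 / (N : ℝ))
  have i2 := (h.integrable_offDiag_pow n 2).const_mul K
  calc _ ≤ ∫ X, ((1 + 1 / (N : ℝ)) * offDiagSum Y n X ^ 4 + K * offDiagSum Y n X ^ 2
              + 96 * v * B ^ 3 * N ^ 2) ∂(Measure.pi fun _ => μ) := by
          refine integral_mono_of_nonneg (.of_forall fun X => ?_)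
            ((i4.add i2).add (integrable_const _)) (.of_forall fun X => ?_)
          · exact integral_nonneg fun x => by positivity
          · obtain ⟨i, hi⟩ := h.integral_quadratic_le (vecSum Y n X)
              (offDiagSum Y n X ^ 4) (8 * offDiagSum Y n X ^ 3)
              (c := 32 * offDiagSum Y n X ^ 2 + 48 * ‖vecSum Y n X‖ ^ 2 * B) (by positivity)
            refine (integral_mono_of_nonneg (.of_forall fun x => by positivity) i
              (.of_forall fun x => ?_)).trans (hi.trans ?_)
            · simp only [offDiag_cons]
              refine cons_pow_four_le ?_
              have := pow_le_pow_left₀ (abs_nonneg _) (h.abs_inner_le (vecSum Y n X) x) 2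
              rwa [sq_abs, mul_pow, Real.sq_sqrt (by linarith)] at this
            · exact quartic_step (by positivity) (h.sq_norm_le_offDiag n X) hnN
                (by linarith) (by linarith) (by linarith)
    _ ≤ _ := by
          have i42 : Integrable (fun X => (1 + 1 / (N : ℝ)) * offDiagSum Y n X ^ 4
              + K * offDiagSum Y n X ^ 2) (Measure.pi fun _ => μ) := i4.add i2
          rw [integral_add i42 (integrable_const _), integral_add i4 i2,
            integral_const_mul, integral_const_mul]
          have h2 : ∫ X, offDiagSum Y n X ^ 2 ∂(Measure.pi fun _ => μ) ≤ 4 * v * B * N ^ 2 := by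
            refine (h.integral_offDiag_sq_le (by linarith) N n hn.le).trans ?_
            rw [sq, ← mul_assoc]; gcongr
          have h3 : K * ∫ X, offDiagSum Y n X ^ 2 ∂(Measure.pi fun _ => μ)
              ≤ K * (4 * v * B * N ^ 2) := by gcongr
          have h4 : K * (4 * v * B * N ^ 2) + 96 * v * B ^ 3 * N ^ 2
              ≤ 2000 * v ^ 3 * B ^ 2 * N ^ 3 := by
            have hv0 : 0 ≤ v := by linarith
            have hB0 : 0 ≤ B := by linarith
            have g1 : v ^ 3 * B * N ^ 3 ≤ v ^ 3 * B ^ 2 * N ^ 3 := by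
              gcongr; nlinarith
            have g2 : v ^ 2 * B ^ 2 * N ^ 3 ≤ v ^ 3 * B ^ 2 * N ^ 3 := by
              gcongr; linarith
            have g3 : v ^ 2 * B ^ 2 * N ^ 2 ≤ v ^ 3 * B ^ 2 * N ^ 3 := by
              gcongr <;> linarith
            have g4 : v * B ^ 3 * N ^ 2 ≤ 4 * (v ^ 3 * B ^ 2 * N ^ 3) := by
              have : v * B ^ 3 * N ^ 2 = (v * B ^ 2 * N ^ 2) * B := by ring
              have h7 : v * B ^ 2 * (N : ℝ) ^ 2 * B ≤ (v * B ^ 2 * N ^ 2) * (4 * N) := by gcongr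
              have h8 : v * B ^ 2 * (N : ℝ) ^ 3 ≤ v ^ 3 * B ^ 2 * N ^ 3 := by
                gcongr; exact le_self_pow₀ hv (by norm_num)
              nlinarith
            have g5 : K * (4 * v * B * N ^ 2) = 1024 * (v ^ 3 * B * N ^ 3)
              + 128 * (v ^ 2 * B ^ 2 * N ^ 3) + 384 * (v ^ 2 * B ^ 2 * N ^ 2) := by
              rw [hK]; ring
            have g6 : 0 ≤ v ^ 3 * B ^ 2 * (N : ℝ) ^ 3 := by positivity
            linarith
          simp only [integral_const, probReal_univ, one_smul]
          linarith

lemma integral_offDiag_pow_four_le (h : WeakVarBound μ Y B v) (hv : 1 ≤ v) (N : ℕ)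
    (hN : 1 ≤ N) (hB1 : 1 ≤ B) (hBN : B ≤ 4 * N) :
    ∫ X, offDiagSum Y N X ^ 4 ∂(Measure.pi fun _ => μ) ≤ 6000 * v ^ 3 * B ^ 2 * N ^ 4 := by
  have hN' : (1 : ℝ) ≤ N := by exact_mod_cast hN
  have key : ∀ n ≤ N, ∫ X, offDiagSum Y n X ^ 4 ∂(Measure.pi fun _ => μ) ≤
      n * (1 + 1 / (N : ℝ)) ^ n * (2000 * v ^ 3 * B ^ 2 * N ^ 3) := by
    intro n
    induction n with
    | zero => intro _; simp [offDiagSum, vecSum]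
    | succ n ih =>
      intro hn
      refine (h.integral_offDiag_pow_four_step hv N n hn hB1 hBN).trans ?_
      have h1 := mul_le_mul_of_nonneg_left (ih (by omega)) (by positivity : 0 ≤ 1 + 1 / (N : ℝ))
      have h2 : (1 : ℝ) ≤ (1 + 1 / (N : ℝ)) ^ (n + 1) :=
        one_le_pow₀ (by have : 0 ≤ 1 / (N : ℝ) := by positivity
                        linarith)
      have h3 : 0 ≤ 2000 * v ^ 3 * B ^ 2 * (N : ℝ) ^ 3 := by positivity
      have h4 := mul_le_mul_of_nonneg_right h2 h3
      push_cast
      calc _ ≤ (1 + 1 / (N : ℝ)) * (n * (1 + 1 / (N : ℝ)) ^ n * (2000 * v ^ 3 * B ^ 2 * N ^ 3))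
            + (1 + 1 / (N : ℝ)) ^ (n + 1) * (2000 * v ^ 3 * B ^ 2 * N ^ 3) := by linarith
        _ = _ := by ring
  refine (key N le_rfl).trans ?_
  have h1 : (1 + 1 / (N : ℝ)) ^ N ≤ 3 := by
    calc (1 + 1 / (N : ℝ)) ^ N ≤ (Real.exp (1 / N)) ^ N := by
          gcongr
          linarith [Real.add_one_le_exp (1 / (N : ℝ))]
      _ = Real.exp 1 := by
          rw [← Real.exp_nat_mul]
          congr 1
          field_simp
      _ ≤ 3 := by linarith [Real.exp_one_lt_d9]
  calc _ ≤ N * 3 * (2000 * v ^ 3 * B ^ 2 * (N : ℝ) ^ 3) := by gcongr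
    _ = _ := by ring

lemma max_sub_zero_le_pow_four {a c : ℝ} (hc : 0 < c) : max (a - c) 0 ≤ a ^ 4 / c ^ 3 := by
  refine max_le ?_ (by positivity)
  rw [le_div_iff₀ (by positivity)]
  rcases le_or_gt a c with h | h
  · exact (mul_nonpos_of_nonpos_of_nonneg (by linarith) (by positivity)).trans (by positivity)
  · have h1 : a - c ≤ a := by linarith
    have h2 : 0 ≤ a := by linarith
    calc (a - c) * c ^ 3 ≤ a * a ^ 3 := by gcongr
      _ = a ^ 4 := by ring

/-- The squared norm of the empirical mean exceeds three times its crude bound only by a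
remainder of order `1 / (n B)` in expectation. -/
lemma integral_excess_le (h : WeakVarBound μ Y B v) (hv : 1 ≤ v) (N : ℕ)
    (hN : 1 ≤ N) (hB1 : 1 ≤ B) (hBN : B ≤ 4 * N) :
    ∫ X, max (‖vecSum Y N X‖ ^ 2 / N ^ 2 - 3 * B / N) 0 ∂(Measure.pi fun _ => μ)
      ≤ 750 * v ^ 3 / (N * B) := by
  have hN' : (1 : ℝ) ≤ N := by exact_mod_cast hN
  have hN0 : (0 : ℝ) < N := by linarith
  have hB0 : 0 < B := by linarith
  calc _ ≤ ∫ X, (1 / (N ^ 5 * (2 * B) ^ 3)) * offDiagSum Y N X ^ 4 ∂(Measure.pi fun _ => μ) := by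
        refine integral_mono_of_nonneg (.of_forall fun X => le_max_right _ _)
          ((h.integrable_offDiag_pow N 4).const_mul _) (.of_forall fun X => ?_)
        have h1 := h.sq_norm_le_offDiag N X
        have h2 : ‖vecSum Y N X‖ ^ 2 / N ^ 2 - 3 * B / N
            ≤ offDiagSum Y N X / N ^ 2 - 2 * B / N := by
          have : ‖vecSum Y N X‖ ^ 2 / (N : ℝ) ^ 2 ≤ (offDiagSum Y N X + N * B) / N ^ 2 := by gcongr
          have h3 : (offDiagSum Y N X + N * B) / (N : ℝ) ^ 2 = offDiagSum Y N X / N ^ 2 + B / N := by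
            field_simp
          have h4 : 3 * B / N = 2 * B / N + B / N := by ring
          linarith
        refine (max_le_max_right 0 h2).trans
          ((max_sub_zero_le_pow_four (by positivity)).trans (le_of_eq ?_))
        field_simp
    _ ≤ (1 / (N ^ 5 * (2 * B) ^ 3)) * (6000 * v ^ 3 * B ^ 2 * N ^ 4) := by
        rw [integral_const_mul]
        gcongr
        exact h.integral_offDiag_pow_four_le hv N hN hB1 hBN
    _ = _ := by
        field_simp
        norm_num

end WeakVarBound

end Moments

section Fourier

variable {d : ℕ}

lemma continuous_phi (k : Fin d → ℤ) : Continuous (phi d k) := by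
  unfold phi
  fun_prop

lemma norm_phi (k : Fin d → ℤ) (x : Fin d → ℝ) : ‖phi d k x‖ = 1 := by
  have : Complex.I * (2 * Real.pi) * ∑ i, (k i : ℂ) * (x i : ℂ)
      = ((2 * Real.pi * ∑ i, (k i : ℝ) * x i : ℝ) : ℂ) * Complex.I := by
    push_cast
    ring
  rw [phi, this, Complex.norm_exp_ofReal_mul_I]

lemma conj_phi (k : Fin d → ℤ) (x : Fin d → ℝ) :
    (starRingEnd ℂ) (phi d k x) = phi d (-k) x := by
  rw [phi, phi, ← Complex.exp_conj]
  congr 1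
  have h2 : (starRingEnd ℂ) 2 = 2 := map_ofNat _ 2
  simp [map_sum, h2]

lemma phi_mul_phi (k l : Fin d → ℤ) (x : Fin d → ℝ) :
    phi d k x * phi d l x = phi d (k + l) x := by
  rw [phi, phi, phi, ← Complex.exp_add, ← mul_add, ← Finset.sum_add_distrib]
  simp [add_mul]

lemma phi_eq_prod (k : Fin d → ℤ) (x : Fin d → ℝ) :
    phi d k x = ∏ i, Complex.exp (2 * Real.pi * Complex.I * k i * x i) := by
  rw [phi, ← Complex.exp_sum, Finset.mul_sum]
  congr 1
  refine Finset.sum_congr rfl fun i _ => ?_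
  ring

lemma volume_restrict_cube :
    (volume : Measure (Fin d → ℝ)).restrict (cube d) =
      Measure.pi fun _ : Fin d => (volume : Measure ℝ).restrict (Set.Icc 0 1) := by
  rw [← Measure.restrict_pi_pi, Set.pi_univ_Icc]
  rfl

instance isProbabilityMeasure_cube :
    IsProbabilityMeasure ((volume : Measure (Fin d → ℝ)).restrict (cube d)) := by
  rw [volume_restrict_cube]
  have : IsProbabilityMeasure ((volume : Measure ℝ).restrict (Set.Icc 0 1)) := ⟨by simp⟩
  infer_instance

lemma integral_exp_int (m : ℤ) :
    ∫ x in Set.Icc (0 : ℝ) 1, Complex.exp (2 * Real.pi * Complex.I * m * x)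
      = if m = 0 then 1 else 0 := by
  rw [integral_Icc_eq_integral_Ioc, ← intervalIntegral.integral_of_le zero_le_one]
  split_ifs with h
  · simp [h]
  · have hc : (2 * Real.pi * Complex.I * m : ℂ) ≠ 0 := by
      simp [Real.pi_ne_zero, h]
    rw [integral_exp_mul_complex hc]
    have : Complex.exp (2 * Real.pi * Complex.I * m) = 1 := by
      rw [mul_comm]; exact Complex.exp_int_mul_two_pi_mul_I m
    simp [this]

lemma integral_phi (k : Fin d → ℤ) : ∫ x in cube d, phi d k x = if k = 0 then 1 else 0 := by
  simp_rw [phi_eq_prod]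
  rw [volume_restrict_cube, integral_fintype_prod_eq_prod
    (fun i (t : ℝ) => Complex.exp (2 * Real.pi * Complex.I * k i * t))]
  simp_rw [integral_exp_int, Finset.prod_ite_zero]
  simp [funext_iff]

lemma integral_phi_mul_conj (k l : Fin d → ℤ) :
    ∫ x in cube d, phi d k x * (starRingEnd ℂ) (phi d l x) = if k = l then 1 else 0 := by
  simp_rw [conj_phi, phi_mul_phi, integral_phi, ← sub_eq_add_neg, sub_eq_zero]

/-- The trigonometric polynomial with coefficients `c` and frequencies in `s`. -/
def trigPoly (s : Finset (Fin d → ℤ)) (c : (Fin d → ℤ) → ℂ) (x : Fin d → ℝ) : ℂ :=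
  ∑ k ∈ s, c k * phi d k x

variable (s t : Finset (Fin d → ℤ)) (c c' : (Fin d → ℤ) → ℂ)

lemma continuous_trigPoly : Continuous (trigPoly s c) := by
  have := @continuous_phi d
  unfold trigPoly
  fun_prop

lemma norm_trigPoly_le (x : Fin d → ℝ) : ‖trigPoly s c x‖ ≤ ∑ k ∈ s, ‖c k‖ := by
  refine (norm_sum_le _ _).trans (Finset.sum_le_sum fun k _ => ?_)
  rw [norm_mul, norm_phi, mul_one]

lemma memLp_trigPoly (p : ENNReal) : MemLp (trigPoly s c) p (volume.restrict (cube d)) :=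
  MemLp.of_bound (continuous_trigPoly s c).aestronglyMeasurable _
    (.of_forall (norm_trigPoly_le s c))

lemma integrable_mul_conj_phi {g : (Fin d → ℝ) → ℂ} {μ : Measure (Fin d → ℝ)}
    (hg : Integrable g μ) (k : Fin d → ℤ) :
    Integrable (fun x => g x * (starRingEnd ℂ) (phi d k x)) μ := by
  refine hg.mul_bdd (c := 1) ?_ (.of_forall fun x => ?_)
  · exact (Complex.continuous_conj.comp (continuous_phi k)).aestronglyMeasurable
  · simp [norm_phi]

lemma fCoeff_trigPoly (l : Fin d → ℤ) :
    fCoeff d (trigPoly s c) l = if l ∈ s then c l else 0 := by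
  have hi : ∀ k ∈ s, Integrable (fun x => c k * (phi d k x * (starRingEnd ℂ) (phi d l x)))
      (volume.restrict (cube d)) := fun k _ => by
    refine Integrable.const_mul (integrable_mul_conj_phi ?_ l) _
    exact Integrable.of_bound (continuous_phi k).aestronglyMeasurable 1
      (.of_forall fun x => (norm_phi k x).le)
  simp_rw [fCoeff, trigPoly, Finset.sum_mul, mul_assoc]
  rw [integral_finsetSum _ hi]
  simp_rw [integral_const_mul, integral_phi_mul_conj]
  simp

lemma fCoeff_sub {g h : (Fin d → ℝ) → ℂ} (hg : Integrable g (volume.restrict (cube d)))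
    (hh : Integrable h (volume.restrict (cube d))) (k : Fin d → ℤ) :
    fCoeff d (fun x => g x - h x) k = fCoeff d g k - fCoeff d h k := by
  simp_rw [fCoeff, sub_mul]
  exact integral_sub (integrable_mul_conj_phi hg k) (integrable_mul_conj_phi hh k)

/-- Pairing with a trigonometric polynomial. -/
lemma integral_mul_conj_trigPoly {g : (Fin d → ℝ) → ℂ}
    (hg : Integrable g (volume.restrict (cube d))) :
    ∫ x in cube d, g x * (starRingEnd ℂ) (trigPoly s c x)
      = ∑ k ∈ s, fCoeff d g k * (starRingEnd ℂ) (c k) := by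
  have : ∀ x, g x * (starRingEnd ℂ) (trigPoly s c x)
      = ∑ k ∈ s, (g x * (starRingEnd ℂ) (phi d k x)) * (starRingEnd ℂ) (c k) := fun x => by
    simp only [trigPoly, map_sum, map_mul, Finset.mul_sum]
    refine Finset.sum_congr rfl fun k _ => ?_
    ring
  simp_rw [this]
  rw [integral_finsetSum _ fun k _ => (integrable_mul_conj_phi hg k).mul_const _]
  simp_rw [integral_mul_const]
  rfl

lemma l2sq_trigPoly : l2sq d (trigPoly s c) = ∑ k ∈ s, ‖c k‖ ^ 2 := by
  have h := integral_mul_conj_trigPoly s c ((memLp_trigPoly s c 1).integrable le_rfl)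
  have h2 : ∀ k ∈ s, fCoeff d (trigPoly s c) k * (starRingEnd ℂ) (c k)
      = ((‖c k‖ ^ 2 : ℝ) : ℂ) := fun k hk => by
    rw [fCoeff_trigPoly, if_pos hk, Complex.mul_conj, Complex.normSq_eq_norm_sq]
  simp_rw [Complex.mul_conj, Complex.normSq_eq_norm_sq] at h
  rw [Finset.sum_congr rfl h2, integral_complex_ofReal, ← Complex.ofReal_sum] at h
  exact_mod_cast h

lemma l2sq_nonneg (g : (Fin d → ℝ) → ℂ) : 0 ≤ l2sq d g :=
  integral_nonneg fun x => by positivity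

lemma integrable_sq_norm {g : (Fin d → ℝ) → ℂ} (hg : MemLp g 2 (volume.restrict (cube d))) :
    Integrable (fun x => ‖g x‖ ^ 2) (volume.restrict (cube d)) :=
  (memLp_two_iff_integrable_sq_norm hg.1).1 hg

lemma l2sq_add_le {g h : (Fin d → ℝ) → ℂ} (hg : MemLp g 2 (volume.restrict (cube d)))
    (hh : MemLp h 2 (volume.restrict (cube d))) :
    l2sq d (fun x => g x + h x) ≤ 2 * l2sq d g + 2 * l2sq d h := by
  have ig := (integrable_sq_norm hg).const_mul 2
  have ih := (integrable_sq_norm hh).const_mul 2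
  unfold l2sq
  rw [← integral_const_mul, ← integral_const_mul, ← integral_add ig ih]
  refine integral_mono (integrable_sq_norm (hg.add hh)) (ig.add ih) fun x => ?_
  have := norm_add_le (g x) (h x)
  have h0 := norm_nonneg (g x + h x)
  nlinarith [sq_nonneg (‖g x‖ - ‖h x‖)]

/-- Bessel's inequality. -/
lemma sum_sq_fCoeff_le {g : (Fin d → ℝ) → ℂ} (hg : MemLp g 2 (volume.restrict (cube d))) :
    ∑ k ∈ s, ‖fCoeff d g k‖ ^ 2 ≤ l2sq d g := by
  set P := trigPoly s (fCoeff d g) with hP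
  have hP2 : MemLp P 2 (volume.restrict (cube d)) := memLp_trigPoly s _ 2
  have hgP : Integrable (fun x => g x * (starRingEnd ℂ) (P x)) (volume.restrict (cube d)) := by
    have hPc : MemLp (fun x => (starRingEnd ℂ) (P x)) 2 (volume.restrict (cube d)) := hP2.star
    exact hg.integrable_mul hPc
  have hpair : ∫ x in cube d, (g x * (starRingEnd ℂ) (P x)).re = ∑ k ∈ s, ‖fCoeff d g k‖ ^ 2 := by
    have h := integral_mul_conj_trigPoly s (fCoeff d g) (hg.integrable one_le_two)
    have h3 : ∫ x in cube d, (g x * (starRingEnd ℂ) (P x)).re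
        = (∫ x in cube d, g x * (starRingEnd ℂ) (P x)).re := integral_re hgP
    rw [h3, hP, h]
    simp_rw [Complex.mul_conj, Complex.normSq_eq_norm_sq, ← Complex.ofReal_sum, Complex.ofReal_re]
  have hpos : 0 ≤ ∫ x in cube d, (‖g x‖ ^ 2 - 2 * (g x * (starRingEnd ℂ) (P x)).re + ‖P x‖ ^ 2) := by
    refine integral_nonneg fun x => ?_
    have h4 := Complex.normSq_sub (g x) (P x)
    have h5 := Complex.normSq_nonneg (g x - P x)
    rw [Complex.normSq_eq_norm_sq (g x), Complex.normSq_eq_norm_sq (P x)] at h4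
    show 0 ≤ _
    linarith
  have hgre : Integrable (fun x => (g x * (starRingEnd ℂ) (P x)).re) (volume.restrict (cube d)) :=
    hgP.re
  have i1 : Integrable (fun x => ‖g x‖ ^ 2 - 2 * (g x * (starRingEnd ℂ) (P x)).re)
      (volume.restrict (cube d)) := (integrable_sq_norm hg).sub (hgre.const_mul 2)
  rw [integral_add i1 (integrable_sq_norm hP2),
    integral_sub (integrable_sq_norm hg) (hgre.const_mul 2), integral_const_mul, hpair] at hpos
  have h6 : ∫ x in cube d, ‖P x‖ ^ 2 = ∑ k ∈ s, ‖fCoeff d g k‖ ^ 2 := l2sq_trigPoly s _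
  unfold l2sq
  linarith

lemma projM_eq_trigPoly (M : ℕ) (g : (Fin d → ℝ) → ℂ) :
    projM d M g = trigPoly (box d M) (fCoeff d g) := rfl

lemma memLp_sub_projM {g : (Fin d → ℝ) → ℂ} (hg : MemLp g 2 (volume.restrict (cube d))) (M : ℕ) :
    MemLp (fun x => g x - projM d M g x) 2 (volume.restrict (cube d)) :=
  hg.sub (memLp_trigPoly _ _ 2)

/-- Fourier coefficients outside the box are controlled by the bias. -/
lemma sum_sq_fCoeff_outside_le {g : (Fin d → ℝ) → ℂ}
    (hg : MemLp g 2 (volume.restrict (cube d))) (M : ℕ) :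
    ∑ k ∈ s, (if k ∈ box d M then 0 else ‖fCoeff d g k‖ ^ 2)
      ≤ l2sq d (fun x => g x - projM d M g x) := by
  refine le_trans (Finset.sum_le_sum fun k _ => ?_)
    (sum_sq_fCoeff_le s (memLp_sub_projM hg M))
  split_ifs with h
  · positivity
  · rw [projM_eq_trigPoly, fCoeff_sub (hg.integrable one_le_two)
      ((memLp_trigPoly (box d M) (fCoeff d g) 1).integrable le_rfl),
      fCoeff_trigPoly, if_neg h, sub_zero]

lemma l2sq_projM_trigPoly_sub (M : ℕ) :
    l2sq d (fun x => projM d M (trigPoly s c) x - trigPoly (box d M) c' x)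
      = ∑ k ∈ box d M, ‖(if k ∈ s then c k else 0) - c' k‖ ^ 2 := by
  rw [← l2sq_trigPoly]
  congr 1
  ext x
  simp only [projM, trigPoly, fCoeff_trigPoly, sub_mul, Finset.sum_sub_distrib]

lemma box_subset {M M' : ℕ} (h : M ≤ M') : box d M ⊆ box d M' := by
  refine Fintype.piFinset_subset _ _ fun _ => Finset.Icc_subset_Icc ?_ ?_ <;> omega

lemma card_box (M : ℕ) : (box d M).card = (2 * M + 1) ^ d := by
  simp only [_root_.box, Fintype.card_piFinset_const, Int.card_Icc]
  congr 1
  omega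

lemma projM_trigPoly_of_subset {M : ℕ} (h : s ⊆ box d M) :
    projM d M (trigPoly s c) = trigPoly s c := by
  ext x
  simp only [projM, trigPoly, fCoeff_trigPoly, ite_mul, zero_mul]
  rw [Finset.sum_ite_mem, Finset.inter_eq_right.2 h]

end Fourier

section Noise

instance isProbabilityMeasure_stdCGauss : IsProbabilityMeasure stdCGauss :=
  Measure.isProbabilityMeasure_map (by fun_prop)

lemma integral_exp_sq_gaussian :
    ∫ x, Real.exp (x ^ 2 / 4) ∂(gaussianReal 0 1) = √2 := by
  rw [integral_gaussianReal_eq_integral_smul one_ne_zero]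
  have : ∀ x : ℝ, gaussianPDFReal 0 1 x • Real.exp (x ^ 2 / 4)
      = (√(2 * Real.pi))⁻¹ * Real.exp (-(1 / 4) * x ^ 2) := fun x => by
    simp only [gaussianPDFReal, NNReal.coe_one, mul_one, sub_zero, smul_eq_mul]
    rw [mul_assoc, ← Real.exp_add]
    congr 2
    ring
  simp_rw [this]
  rw [integral_const_mul, integral_gaussian, ← Real.sqrt_inv, ← Real.sqrt_mul (by positivity)]
  congr 1
  field_simp
  norm_num

lemma integral_exp_sq_stdCGauss :
    ∫ z, Real.exp (‖z‖ ^ 2 / 4) ∂stdCGauss = 2 := by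
  rw [stdCGauss, integral_map (by fun_prop) (by fun_prop)]
  have : ∀ p : ℝ × ℝ, Real.exp (‖(p.1 : ℂ) + (p.2 : ℂ) * Complex.I‖ ^ 2 / 4)
      = Real.exp (p.1 ^ 2 / 4) * Real.exp (p.2 ^ 2 / 4) := fun p => by
    rw [← Complex.normSq_eq_norm_sq, Complex.normSq_add_mul_I, add_div, Real.exp_add]
  simp_rw [this]
  rw [integral_prod_mul (fun x : ℝ => Real.exp (x ^ 2 / 4)) (fun x : ℝ => Real.exp (x ^ 2 / 4)),
    integral_exp_sq_gaussian, Real.mul_self_sqrt (by norm_num)]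

variable (ι : Type*) [Fintype ι]

lemma integral_exp_sum_sq_noise :
    ∫ z, Real.exp ((∑ i, ‖z i‖ ^ 2) / 4) ∂(Measure.pi fun _ : ι => stdCGauss)
      = 2 ^ Fintype.card ι := by
  simp_rw [Finset.sum_div, Real.exp_sum]
  rw [integral_fintype_prod_eq_pow (fun z : ℂ => Real.exp (‖z‖ ^ 2 / 4)),
    integral_exp_sq_stdCGauss]

lemma integrable_exp_sum_sq_noise :
    Integrable (fun z : ι → ℂ => Real.exp ((∑ i, ‖z i‖ ^ 2) / 4))
      (Measure.pi fun _ : ι => stdCGauss) := by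
  by_contra h
  have h2 := integral_undef h
  rw [integral_exp_sum_sq_noise] at h2
  exact absurd h2 (by positivity)

variable {ι} in
lemma integrable_sq_noise (i : ι) :
    Integrable (fun z : ι → ℂ => ‖z i‖ ^ 2) (Measure.pi fun _ : ι => stdCGauss) ∧
    ∫ z, ‖z i‖ ^ 2 ∂(Measure.pi fun _ : ι => stdCGauss) ≤ 8 := by
  have mp := measurePreserving_eval (fun _ : ι => stdCGauss) i
  have he : Integrable (fun z : ℂ => Real.exp (‖z‖ ^ 2 / 4)) stdCGauss := by
    by_contra h
    have h2 := integral_undef h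
    rw [integral_exp_sq_stdCGauss] at h2
    norm_num at h2
  have hle : ∀ z : ℂ, ‖z‖ ^ 2 ≤ 4 * Real.exp (‖z‖ ^ 2 / 4) := fun z => by
    have := Real.add_one_le_exp (‖z‖ ^ 2 / 4)
    linarith
  have hi : Integrable (fun z : ℂ => ‖z‖ ^ 2) stdCGauss := by
    refine (he.const_mul 4).mono' (by fun_prop) (.of_forall fun z => ?_)
    rw [Real.norm_of_nonneg (by positivity)]
    exact hle z
  refine ⟨mp.integrable_comp_of_integrable hi, ?_⟩
  have h3 : ∫ z, ‖z i‖ ^ 2 ∂(Measure.pi fun _ : ι => stdCGauss) = ∫ z, ‖z‖ ^ 2 ∂stdCGauss := by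
    have h4 := integral_map (μ := Measure.pi fun _ : ι => stdCGauss)
      (f := fun z : ℂ => ‖z‖ ^ 2) mp.measurable.aemeasurable (by fun_prop)
    rw [mp.map_eq] at h4
    exact h4.symm
  rw [h3]
  calc _ ≤ ∫ z, 4 * Real.exp (‖z‖ ^ 2 / 4) ∂stdCGauss :=
        integral_mono hi (he.const_mul 4) hle
    _ = 8 := by
        rw [integral_const_mul, integral_exp_sq_stdCGauss]
        norm_num

lemma integrable_sum_sq_noise :
    Integrable (fun z : ι → ℂ => ∑ i, ‖z i‖ ^ 2) (Measure.pi fun _ : ι => stdCGauss) :=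
  integrable_finsetSum _ fun i _ => (integrable_sq_noise i).1

lemma integral_sum_sq_noise_le :
    ∫ z, ∑ i, ‖z i‖ ^ 2 ∂(Measure.pi fun _ : ι => stdCGauss) ≤ 8 * Fintype.card ι := by
  rw [integral_finsetSum _ fun i _ => (integrable_sq_noise i).1]
  refine (Finset.sum_le_sum fun i _ => (integrable_sq_noise i).2).trans ?_
  simp [mul_comm]

lemma four_le_exp : (4 : ℝ) ≤ Real.exp (3 / 2) := by
  have h1 : Real.exp (3 / 2) ^ 2 = Real.exp 1 ^ 3 := by
    rw [← Real.exp_nat_mul, ← Real.exp_nat_mul]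
    norm_num
  have h2 : (2.7 : ℝ) ^ 3 ≤ Real.exp 1 ^ 3 := by
    gcongr
    linarith [Real.exp_one_gt_d9]
  have h3 := Real.exp_pos (3 / 2)
  nlinarith

lemma integral_noise_excess_le :
    ∫ z, max (∑ i, ‖z i‖ ^ 2 - 6 * Fintype.card ι) 0 ∂(Measure.pi fun _ : ι => stdCGauss)
      ≤ 4 * (1 / 2) ^ Fintype.card ι := by
  set D := Fintype.card ι with hD
  calc _ ≤ ∫ z, (4 * (1 / 4) ^ D) * Real.exp ((∑ i, ‖z i‖ ^ 2) / 4)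
          ∂(Measure.pi fun _ : ι => stdCGauss) := by
        refine integral_mono_of_nonneg (.of_forall fun z => le_max_right _ _)
          ((integrable_exp_sum_sq_noise ι).const_mul _) (.of_forall fun z => ?_)
        refine max_le ?_ (by positivity)
        have h1 := Real.add_one_le_exp ((∑ i, ‖z i‖ ^ 2 - 6 * D) / 4)
        have h2 : Real.exp ((∑ i, ‖z i‖ ^ 2 - 6 * D) / 4)
            = (Real.exp (3 / 2))⁻¹ ^ D * Real.exp ((∑ i, ‖z i‖ ^ 2) / 4) := by
          rw [← Real.exp_neg, ← Real.exp_nat_mul, ← Real.exp_add]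
          congr 1
          ring
        have h3 : (Real.exp (3 / 2))⁻¹ ^ D ≤ (1 / 4 : ℝ) ^ D := by
          gcongr
          rw [one_div]
          exact inv_anti₀ (by norm_num) four_le_exp
        have h4 := mul_le_mul_of_nonneg_right h3 (Real.exp_pos ((∑ i, ‖z i‖ ^ 2) / 4)).le
        show _ ≤ _
        linarith
    _ = _ := by
        rw [integral_const_mul, integral_exp_sum_sq_noise, mul_assoc, ← mul_pow]
        norm_num

lemma sum_geometric_three_quarters_le (s : Finset ℕ) : ∑ M ∈ s, (3 / 4 : ℝ) ^ M ≤ 4 := by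
  refine (Summable.sum_le_tsum s (fun _ _ => by positivity)
    (summable_geometric_of_lt_one (by norm_num) (by norm_num))).trans ?_
  rw [tsum_geometric_of_lt_one (by norm_num) (by norm_num)]
  norm_num

lemma nat_mul_half_pow_le {M D : ℕ} (h : M ≤ D) :
    (D : ℝ) * (1 / 2) ^ D ≤ 2 * (3 / 4) ^ M := by
  have h1 : (D : ℝ) ≤ 2 * (3 / 2) ^ D := by
    have := one_add_mul_le_pow (by norm_num : (-2 : ℝ) ≤ 1 / 2) D
    norm_num at this ⊢
    linarith
  calc (D : ℝ) * (1 / 2) ^ D ≤ (2 * (3 / 2) ^ D) * (1 / 2) ^ D := by gcongr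
    _ = 2 * (3 / 4) ^ D := by rw [mul_assoc, ← mul_pow]; norm_num
    _ ≤ 2 * (3 / 4) ^ M := by
        gcongr 2 * ?_
        exact pow_le_pow_of_le_one (by norm_num) (by norm_num) h

lemma le_dim {d : ℕ} (hd : 1 ≤ d) (M : ℕ) : M ≤ (2 * M + 1) ^ d :=
  (by omega : M ≤ 2 * M + 1).trans (Nat.le_self_pow (by omega) _)

lemma sigmaSel_sq {d n : ℕ} {𝓜 : Finset ℕ} {ρ : ℝ} (hρ : 0 < ρ) (M : ℕ) :
    sigmaSel d n 𝓜 ρ M ^ 2 = 4 * ((2 * M + 1 : ℕ) : ℝ) ^ d * 𝓜.card / (n ^ 2 * ρ) := by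
  rw [sigmaSel, div_pow, mul_pow, mul_pow, Real.sq_sqrt (by positivity),
    Real.sq_sqrt (by positivity), div_eq_div_iff_comm]
  rcases Nat.eq_zero_or_pos n with h | h
  · simp [h]
  rcases Nat.eq_zero_or_pos 𝓜.card with h2 | h2
  · simp [h2]
  field_simp
  norm_num

lemma sum_sigmaSel_excess_le {d n : ℕ} (hd : 1 ≤ d) {𝓜 : Finset ℕ} {ρ : ℝ} (hρ : 0 < ρ) :
    ∑ M ∈ 𝓜, sigmaSel d n 𝓜 ρ M ^ 2 * (4 * (1 / 2) ^ ((2 * M + 1) ^ d))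
      ≤ 128 * (𝓜.card / ((n : ℝ) ^ 2 * ρ)) := by
  calc _ ≤ ∑ M ∈ 𝓜, (32 * (𝓜.card / ((n : ℝ) ^ 2 * ρ))) * (3 / 4) ^ M := by
        refine Finset.sum_le_sum fun M _ => ?_
        rw [sigmaSel_sq hρ]
        have := nat_mul_half_pow_le (le_dim hd M)
        have h0 : 0 ≤ 16 * (𝓜.card / ((n : ℝ) ^ 2 * ρ)) := by positivity
        have := mul_le_mul_of_nonneg_left this h0
        push_cast at this ⊢
        calc _ = 16 * (𝓜.card / ((n : ℝ) ^ 2 * ρ)) *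
              ((2 * (M : ℝ) + 1) ^ d * (1 / 2) ^ (2 * M + 1) ^ d) := by ring
          _ ≤ _ := this
          _ = _ := by ring
    _ ≤ (32 * (𝓜.card / ((n : ℝ) ^ 2 * ρ))) * 4 := by
        rw [← Finset.mul_sum]
        gcongr
        exact sum_geometric_three_quarters_le 𝓜
    _ = _ := by ring

end Noise

section Data

variable {d : ℕ} {f : (Fin d → ℝ) → ℝ}

lemma IsDensity.ae_nonneg (hf : IsDensity d f) : 0 ≤ᵐ[volume.restrict (cube d)] f :=
  (ae_restrict_mem measurableSet_Icc).mono fun x hx => hf.2.1 x hx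

lemma IsDensity.integrable (hf : IsDensity d f) : Integrable f (volume.restrict (cube d)) := by
  by_contra h
  have := hf.2.2
  rw [integral_undef h] at this
  exact zero_ne_one this

lemma IsDensity.isProbabilityMeasure (hf : IsDensity d f) :
    IsProbabilityMeasure (densMeasure d f) := by
  refine ⟨?_⟩
  rw [densMeasure, withDensity_apply _ MeasurableSet.univ, Measure.restrict_univ,
    ← ofReal_integral_eq_lintegral_ofReal hf.integrable hf.ae_nonneg, hf.2.2, ENNReal.ofReal_one]

lemma IsDensity.integral_densMeasure {F : Type*} [NormedAddCommGroup F] [NormedSpace ℝ F]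
    (hf : IsDensity d f) (g : (Fin d → ℝ) → F) :
    ∫ x, g x ∂densMeasure d f = ∫ x in cube d, f x • g x := by
  rw [densMeasure, integral_withDensity_eq_integral_toReal_smul hf.1.ennreal_ofReal
    (.of_forall fun x => ENNReal.ofReal_lt_top)]
  refine integral_congr_ae (hf.ae_nonneg.mono fun x hx => ?_)
  simp only [ENNReal.toReal_ofReal hx]

lemma IsDensity.integral_conj_phi (hf : IsDensity d f) (k : Fin d → ℤ) :
    ∫ x, (starRingEnd ℂ) (phi d k x) ∂densMeasure d f = fCoeff d (fun x => (f x : ℂ)) k := by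
  simp_rw [hf.integral_densMeasure, fCoeff, Complex.real_smul]

lemma IsDensity.norm_fCoeff_le (hf : IsDensity d f) (k : Fin d → ℤ) :
    ‖fCoeff d (fun x => (f x : ℂ)) k‖ ≤ 1 := by
  have := hf.isProbabilityMeasure
  rw [← hf.integral_conj_phi]
  refine (norm_integral_le_of_norm_le_const (C := 1) (.of_forall fun x => ?_)).trans ?_
  · simp [norm_phi]
  · simp

lemma ae_abs_le_supNorm (hb : eLpNorm (fun x => f x) ⊤ (volume.restrict (cube d)) < ⊤) :
    ∀ᵐ x ∂volume.restrict (cube d), |f x| ≤ supNorm d f := by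
  have h := ae_le_eLpNormEssSup (f := f) (μ := volume.restrict (cube d))
  rw [eLpNorm_exponent_top] at hb
  filter_upwards [h] with x hx
  have := ENNReal.toReal_mono hb.ne hx
  rw [supNorm, eLpNorm_exponent_top]
  simpa using this

lemma IsDensity.memLp_two (hf : IsDensity d f)
    (hb : eLpNorm (fun x => f x) ⊤ (volume.restrict (cube d)) < ⊤) :
    MemLp (fun x => (f x : ℂ)) 2 (volume.restrict (cube d)) :=
  MemLp.of_bound (by have := hf.1; fun_prop) (supNorm d f)
    ((ae_abs_le_supNorm hb).mono fun x hx => by simpa using hx)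

lemma IsDensity.integral_sq_norm_trigPoly_le (hf : IsDensity d f)
    (hb : eLpNorm (fun x => f x) ⊤ (volume.restrict (cube d)) < ⊤)
    (s : Finset (Fin d → ℤ)) (c : (Fin d → ℤ) → ℂ) :
    ∫ x, ‖trigPoly s c x‖ ^ 2 ∂densMeasure d f ≤ supNorm d f * ∑ k ∈ s, ‖c k‖ ^ 2 := by
  rw [hf.integral_densMeasure, ← l2sq_trigPoly, l2sq, ← integral_const_mul]
  refine integral_mono_of_nonneg (hf.ae_nonneg.mono fun x hx => ?_)
    ((integrable_sq_norm (memLp_trigPoly s c 2)).const_mul _)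
    ((ae_abs_le_supNorm hb).mono fun x hx => ?_)
  · exact smul_nonneg hx (by positivity)
  · simp only [smul_eq_mul]
    gcongr
    exact (le_abs_self _).trans hx

/-- The centered vector of conjugate Fourier characters with frequencies in `s`. -/
def centeredChars (f : (Fin d → ℝ) → ℝ) (s : Finset (Fin d → ℤ)) (x : Fin d → ℝ) :
    EuclideanSpace ℂ s :=
  WithLp.toLp 2 fun k => (starRingEnd ℂ) (phi d k x) - fCoeff d (fun x => (f x : ℂ)) k

lemma continuous_centeredChars (s : Finset (Fin d → ℤ)) : Continuous (centeredChars f s) := by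
  refine (PiLp.continuous_toLp 2 _).comp (continuous_pi fun k => ?_)
  exact (Complex.continuous_conj.comp (continuous_phi _)).sub continuous_const

lemma IsDensity.sq_norm_centeredChars_le (hf : IsDensity d f) (s : Finset (Fin d → ℤ))
    (x : Fin d → ℝ) : ‖centeredChars f s x‖ ^ 2 ≤ 4 * s.card := by
  rw [EuclideanSpace.norm_sq_eq]
  calc _ ≤ ∑ k : s, (4 : ℝ) := by
        refine Finset.sum_le_sum fun k _ => ?_
        have h1 : ‖centeredChars f s x k‖ ≤ 2 := by
          refine (norm_sub_le _ _).trans ?_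
          have := hf.norm_fCoeff_le k
          rw [RCLike.norm_conj, norm_phi]
          linarith
        nlinarith [norm_nonneg (centeredChars f s x k)]
    _ = _ := by simp [mul_comm]

lemma inner_centeredChars (s : Finset (Fin d → ℤ)) (u : EuclideanSpace ℂ s) (x : Fin d → ℝ) :
    inner ℝ u (centeredChars f s x) =
      (∑ k : s, ((starRingEnd ℂ) (phi d k x) - fCoeff d (fun x => (f x : ℂ)) k)
        * (starRingEnd ℂ) (u k)).re := by
  rw [PiLp.inner_apply, Complex.re_sum]
  refine Finset.sum_congr rfl fun k _ => ?_
  rw [Complex.inner]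
  rfl

lemma IsDensity.integral_inner_centeredChars (hf : IsDensity d f) (s : Finset (Fin d → ℤ))
    (u : EuclideanSpace ℂ s) :
    ∫ x, inner ℝ u (centeredChars f s x) ∂densMeasure d f = 0 := by
  have := hf.isProbabilityMeasure
  have hi : ∀ k : s, Integrable (fun x => (starRingEnd ℂ) (phi d k x)) (densMeasure d f) :=
    fun k => Integrable.of_bound
      (Complex.continuous_conj.comp (continuous_phi _)).aestronglyMeasurable 1
      (.of_forall fun x => by simp [norm_phi])
  have hi2 : ∀ k ∈ (Finset.univ : Finset s), Integrable (fun x => ((starRingEnd ℂ) (phi d k x)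
      - fCoeff d (fun x => (f x : ℂ)) k) * (starRingEnd ℂ) (u k)) (densMeasure d f) :=
    fun k _ => ((hi k).sub (integrable_const _)).mul_const _
  simp_rw [inner_centeredChars]
  have h3 := integral_re (integrable_finsetSum _ hi2)
  refine h3.trans ?_
  rw [integral_finsetSum _ hi2]
  have h4 : ∀ k : s, ∫ x, ((starRingEnd ℂ) (phi d k x)
      - fCoeff d (fun x => (f x : ℂ)) k) * (starRingEnd ℂ) (u k) ∂(densMeasure d f) = 0 := by
    intro k
    rw [integral_mul_const, integral_sub (hi k) (integrable_const _), hf.integral_conj_phi]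
    simp
  simp [h4]

lemma IsDensity.weakVarBound (hf : IsDensity d f)
    (hb : eLpNorm (fun x => f x) ⊤ (volume.restrict (cube d)) < ⊤) (s : Finset (Fin d → ℤ)) :
    WeakVarBound (densMeasure d f) (centeredChars f s) (4 * s.card) (1 + supNorm d f) where
  meas := (continuous_centeredChars s).measurable
  bound := hf.sq_norm_centeredChars_le s
  centered := hf.integral_inner_centeredChars s
  weakVar u := by
    have := hf.isProbabilityMeasure
    classical
    set c : (Fin d → ℤ) → ℂ := fun k => if h : k ∈ s then u ⟨k, h⟩ else 0 with hc
    set a : ℝ := (∑ k : s, fCoeff d (fun x => (f x : ℂ)) k * (starRingEnd ℂ) (u k)).re with ha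
    have hc_sum : ∑ k ∈ s, ‖c k‖ ^ 2 = ‖u‖ ^ 2 := by
      rw [EuclideanSpace.norm_sq_eq, ← Finset.sum_coe_sort]
      simp [hc]
    have hpoly : ∀ x, inner ℝ u (centeredChars f s x) = (trigPoly s c x).re - a := fun x => by
      rw [inner_centeredChars, ha]
      simp only [sub_mul, Finset.sum_sub_distrib, Complex.sub_re]
      congr 1
      have hck : ∀ k : s, (starRingEnd ℂ) (phi d k x) * (starRingEnd ℂ) (u k)
          = (starRingEnd ℂ) (c k * phi d k x) := fun k => by
        simp [hc, mul_comm]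
      simp_rw [hck]
      rw [← map_sum, Complex.conj_re, Finset.sum_coe_sort s fun k => c k * phi d k x]
      rfl
    have hcont : Continuous fun x => inner ℝ u (centeredChars f s x) :=
      continuous_const.inner (continuous_centeredChars s)
    have hi : Integrable (fun x => inner ℝ u (centeredChars f s x)) (densMeasure d f) := by
      refine Integrable.of_bound hcont.aestronglyMeasurable (‖u‖ * √(4 * s.card))
        (.of_forall fun x => (norm_inner_le_norm _ _).trans ?_)
      gcongr
      exact Real.le_sqrt_of_sq_le (hf.sq_norm_centeredChars_le s x)
    have hi2 : Integrable (fun x => ‖trigPoly s c x‖ ^ 2) (densMeasure d f) := by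
      refine Integrable.of_bound ((continuous_trigPoly s c).norm.pow 2).aestronglyMeasurable
        ((∑ k ∈ s, ‖c k‖) ^ 2) (.of_forall fun x => ?_)
      rw [Real.norm_of_nonneg (by positivity)]
      have := norm_trigPoly_le s c x
      gcongr
    calc _ ≤ ∫ x, (‖trigPoly s c x‖ ^ 2 - 2 * a * inner ℝ u (centeredChars f s x))
            ∂densMeasure d f := by
          refine integral_mono_of_nonneg (.of_forall fun x => by positivity)
            (hi2.sub (hi.const_mul _)) (.of_forall fun x => ?_)
          have h1 : (trigPoly s c x).re ^ 2 ≤ ‖trigPoly s c x‖ ^ 2 := by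
            rw [← sq_abs]
            gcongr
            exact Complex.abs_re_le_norm _
          simp only [hpoly]
          nlinarith [sq_nonneg a]
      _ = ∫ x, ‖trigPoly s c x‖ ^ 2 ∂densMeasure d f := by
          rw [integral_sub hi2 (hi.const_mul _), integral_const_mul,
            hf.integral_inner_centeredChars, mul_zero, sub_zero]
      _ ≤ supNorm d f * ‖u‖ ^ 2 := hc_sum ▸ hf.integral_sq_norm_trigPoly_le hb s c
      _ ≤ _ := by
          gcongr
          linarith

/-- Squared `ℓ²` error of the empirical Fourier coefficients with frequencies in `s`. -/
def empError (n : ℕ) (f : (Fin d → ℝ) → ℝ) (s : Finset (Fin d → ℤ)) (X : Fin n → Fin d → ℝ) : ℝ :=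
  ∑ k ∈ s, ‖empCoeff d n X k - fCoeff d (fun x => (f x : ℂ)) k‖ ^ 2

lemma empError_eq {n : ℕ} (hn : 1 ≤ n) (s : Finset (Fin d → ℤ)) (X : Fin n → Fin d → ℝ) :
    empError n f s X = ‖vecSum (centeredChars f s) n X‖ ^ 2 / n ^ 2 := by
  have hn' : (n : ℂ) ≠ 0 := by exact_mod_cast (by omega : n ≠ 0)
  rw [EuclideanSpace.norm_sq_eq, Finset.sum_div, empError, ← Finset.sum_coe_sort]
  refine Finset.sum_congr rfl fun k _ => ?_
  have h1 : vecSum (centeredChars f s) n X k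
      = n * (empCoeff d n X k - fCoeff d (fun x => (f x : ℂ)) k) := by
    simp only [vecSum, centeredChars, empCoeff, WithLp.ofLp_sum, Finset.sum_apply,
      Finset.sum_sub_distrib]
    field_simp
    simp
  have hn0 : (0 : ℝ) < n := by exact_mod_cast hn
  rw [h1, norm_mul, mul_pow, Complex.norm_natCast]
  field_simp

lemma IsDensity.integrable_empError (hf : IsDensity d f)
    (hb : eLpNorm (fun x => f x) ⊤ (volume.restrict (cube d)) < ⊤) {n : ℕ} (hn : 1 ≤ n)
    (s : Finset (Fin d → ℤ)) :
    Integrable (empError n f s) (Measure.pi fun _ => densMeasure d f) ∧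
    ∫ X, empError n f s X ∂(Measure.pi fun _ => densMeasure d f) ≤ 4 * s.card / n := by
  have := hf.isProbabilityMeasure
  have h := hf.weakVarBound hb s
  have hi := (h.integrable_sq_norm_vecSum n).div_const ((n : ℝ) ^ 2)
  have e : empError n f s = fun X => ‖vecSum (centeredChars f s) n X‖ ^ 2 / (n : ℝ) ^ 2 :=
    funext fun X => empError_eq hn s X
  rw [e]
  refine ⟨hi, ?_⟩
  rw [integral_div, div_le_div_iff₀ (by positivity) (by positivity)]
  have h2 := h.integral_sq_norm_vecSum_le n
  nlinarith [(Nat.cast_nonneg n : (0 : ℝ) ≤ n)]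

lemma IsDensity.integral_empError_excess_le (hf : IsDensity d f)
    (hb : eLpNorm (fun x => f x) ⊤ (volume.restrict (cube d)) < ⊤) {n : ℕ}
    (s : Finset (Fin d → ℤ)) (hs : 1 ≤ s.card) (hsn : s.card ≤ n) :
    ∫ X, max (empError n f s X - 12 * s.card / n) 0 ∂(Measure.pi fun _ => densMeasure d f)
      ≤ 200 * (1 + supNorm d f) ^ 3 / (n * s.card) := by
  have := hf.isProbabilityMeasure
  have hs' : (1 : ℝ) ≤ s.card := by exact_mod_cast hs
  have hsn' : (s.card : ℝ) ≤ n := by exact_mod_cast hsn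
  have h0 : 0 ≤ supNorm d f := ENNReal.toReal_nonneg
  have h := (hf.weakVarBound hb s).integral_excess_le (by linarith) n (by omega)
    (by linarith) (by linarith)
  simp_rw [empError_eq (hs.trans hsn)]
  have e1 : 3 * (4 * (s.card : ℝ)) / n = 12 * s.card / n := by ring
  rw [e1] at h
  refine h.trans ?_
  rw [div_le_div_iff₀ (by nlinarith) (by nlinarith)]
  have : 0 ≤ (1 + supNorm d f) ^ 3 * (n * s.card) := by positivity
  nlinarith

end Data

section Selection

variable {d n : ℕ} {𝓜 : Finset ℕ} {ρ : ℝ} {f : (Fin d → ℝ) → ℝ}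

lemma toIdx_injective (d M : ℕ) : Function.Injective (toIdx d M) := fun ν ν' h => by
  ext i
  have := congrFun h i
  simp only [toIdx] at this
  omega

lemma sum_toIdx {F : Type*} [AddCommMonoid F] (d M : ℕ) (g : (Fin d → ℤ) → F) :
    ∑ ν, g (toIdx d M ν) = ∑ k ∈ box d M, g k := by
  refine Finset.sum_nbij (toIdx d M) (fun ν _ => ?_) (toIdx_injective d M).injOn
    (fun k hk => ?_) (fun _ _ => rfl)
  · simp only [_root_.box, Fintype.mem_piFinset, Finset.mem_Icc, toIdx]
    intro i
    have := (ν i).2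
    omega
  · simp only [_root_.box, Finset.mem_coe, Fintype.mem_piFinset, Finset.mem_Icc] at hk
    refine ⟨fun i => ⟨(k i + M).toNat, by have := hk i; omega⟩, by simp, ?_⟩
    ext i
    have := hk i
    simp only [toIdx]
    omega

/-- The noise added to the `k`-th coefficient of the estimator with cut-off `M`. -/
def noiseCoeff (ρ : ℝ) (M : 𝓜) (ω : SelSpace d n 𝓜) (k : Fin d → ℤ) : ℂ :=
  (sigmaSel d n 𝓜 ρ M : ℂ) * ω.2 M (Function.invFun (toIdx d M) k)

/-- Squared `ℓ²` norm of the noise of the estimator with cut-off `M`. -/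
def noiseError (ρ : ℝ) (M : 𝓜) (ω : SelSpace d n 𝓜) : ℝ :=
  sigmaSel d n 𝓜 ρ M ^ 2 * ∑ ν, ‖ω.2 M ν‖ ^ 2

lemma sum_sq_noiseCoeff (M : 𝓜) (ω : SelSpace d n 𝓜) :
    ∑ k ∈ box d M, ‖noiseCoeff ρ M ω k‖ ^ 2 = noiseError ρ M ω := by
  rw [← sum_toIdx, noiseError, Finset.mul_sum]
  refine Finset.sum_congr rfl fun ν _ => ?_
  rw [noiseCoeff, Function.leftInverse_invFun (toIdx_injective d M) ν, norm_mul, mul_pow,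
    Complex.norm_real, Real.norm_eq_abs, sq_abs]

lemma selEst_eq_trigPoly (M : 𝓜) (ω : SelSpace d n 𝓜) :
    selEst d n 𝓜 ρ M ω
      = trigPoly (box d M) fun k => empCoeff d n ω.1 k + noiseCoeff ρ M ω k := by
  ext x
  rw [trigPoly, ← sum_toIdx, selEst]
  refine Finset.sum_congr rfl fun ν _ => ?_
  rw [noiseCoeff, Function.leftInverse_invFun (toIdx_injective d M) ν]

lemma selEstN_coe (M : 𝓜) (ω : SelSpace d n 𝓜) :
    selEstN d n 𝓜 ρ M ω = selEst d n 𝓜 ρ M ω := dif_pos M.2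

lemma memLp_selEst (M : 𝓜) (ω : SelSpace d n 𝓜) :
    MemLp (selEst d n 𝓜 ρ M ω) 2 (volume.restrict (cube d)) := by
  rw [selEst_eq_trigPoly]
  exact memLp_trigPoly _ _ 2

lemma sq_norm_add_le (a b : ℂ) : ‖a + b‖ ^ 2 ≤ 2 * ‖a‖ ^ 2 + 2 * ‖b‖ ^ 2 := by
  have h := norm_add_le a b
  have h0 := norm_nonneg (a + b)
  nlinarith [sq_nonneg (‖a‖ - ‖b‖)]

lemma sq_norm_add_four_le (a b c e : ℂ) :
    ‖(a + b) + (c + e)‖ ^ 2 ≤ 4 * (‖a‖ ^ 2 + ‖b‖ ^ 2 + ‖c‖ ^ 2 + ‖e‖ ^ 2) := by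
  linarith [sq_norm_add_le (a + b) (c + e), sq_norm_add_le a b, sq_norm_add_le c e]

/-- The squared bias of the projection onto the frequencies in `box d M`. -/
def projBias (f : (Fin d → ℝ) → ℝ) (M : ℕ) : ℝ :=
  l2sq d (fun x => (f x : ℂ) - projM d M (fun y => (f y : ℂ)) x)

/-- The squared distance of the projected `M`-estimator to the `M'`-estimator. -/
def pairDist (ρ : ℝ) (M M' : 𝓜) (ω : SelSpace d n 𝓜) : ℝ :=
  l2sq d (fun x => projM d M' (selEst d n 𝓜 ρ M ω) x - selEst d n 𝓜 ρ M' ω x)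

lemma pairDist_le (hf : MemLp (fun x => (f x : ℂ)) 2 (volume.restrict (cube d))) (M M' : 𝓜)
    (ω : SelSpace d n 𝓜) :
    pairDist ρ M M' ω ≤ 4 * (empError n f (box d M') ω.1 + projBias f M
      + noiseError ρ M ω + noiseError ρ M' ω) := by
  rw [pairDist, selEst_eq_trigPoly M, selEst_eq_trigPoly M', l2sq_projM_trigPoly_sub]
  set θ := fCoeff d (fun x => (f x : ℂ)) with hθ
  calc _ ≤ ∑ k ∈ box d M', 4 * (‖empCoeff d n ω.1 k - θ k‖ ^ 2
          + (if k ∈ box d M then 0 else ‖θ k‖ ^ 2)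
          + (if k ∈ box d M then ‖noiseCoeff ρ M ω k‖ ^ 2 else 0)
          + ‖noiseCoeff ρ M' ω k‖ ^ 2) := by
        refine Finset.sum_le_sum fun k _ => ?_
        split_ifs with h
        · have := sq_norm_add_four_le 0 0 (noiseCoeff ρ M ω k) (-noiseCoeff ρ M' ω k)
          rw [norm_neg, norm_zero] at this
          have e : (empCoeff d n ω.1 k + noiseCoeff ρ M ω k)
              - (empCoeff d n ω.1 k + noiseCoeff ρ M' ω k)
              = (0 + 0) + (noiseCoeff ρ M ω k + -noiseCoeff ρ M' ω k) := by ring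
          rw [e]
          have h2 : 0 ≤ ‖empCoeff d n ω.1 k - θ k‖ ^ 2 := by positivity
          linarith
        · have := sq_norm_add_four_le (empCoeff d n ω.1 k - θ k) (θ k) 0 (noiseCoeff ρ M' ω k)
          rw [norm_zero] at this
          have e : 0 - (empCoeff d n ω.1 k + noiseCoeff ρ M' ω k)
              = -(((empCoeff d n ω.1 k - θ k) + θ k) + (0 + noiseCoeff ρ M' ω k)) := by ring
          rw [e, norm_neg]
          linarith
    _ = 4 * (empError n f (box d M') ω.1
          + ∑ k ∈ box d M', (if k ∈ box d M then 0 else ‖θ k‖ ^ 2)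
          + ∑ k ∈ box d M', (if k ∈ box d M then ‖noiseCoeff ρ M ω k‖ ^ 2 else 0)
          + noiseError ρ M' ω) := by
        rw [← Finset.mul_sum, Finset.sum_add_distrib, Finset.sum_add_distrib,
          Finset.sum_add_distrib, sum_sq_noiseCoeff]
        rfl
    _ ≤ _ := by
        have h1 := sum_sq_fCoeff_outside_le (box d M') hf M
        have h2 : ∑ k ∈ box d M', (if k ∈ box d M then ‖noiseCoeff ρ M ω k‖ ^ 2 else 0)
            ≤ noiseError ρ M ω := by
          rw [Finset.sum_ite_mem, ← sum_sq_noiseCoeff]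
          exact Finset.sum_le_sum_of_subset_of_nonneg Finset.inter_subset_right
            fun _ _ _ => by positivity
        gcongr
        exact h1

lemma pairDist_self (M : 𝓜) (ω : SelSpace d n 𝓜) : pairDist ρ M M ω = 0 := by
  rw [pairDist, selEst_eq_trigPoly, projM_trigPoly_of_subset _ _ subset_rfl]
  simp [l2sq]

lemma l2sq_selEst_sub (M M' : 𝓜) (ω : SelSpace d n 𝓜) (h : (M : ℕ) ≤ M') :
    l2sq d (fun x => selEst d n 𝓜 ρ M ω x - selEst d n 𝓜 ρ M' ω x) = pairDist ρ M M' ω := by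
  rw [pairDist, selEst_eq_trigPoly M, projM_trigPoly_of_subset _ _ (box_subset h)]

lemma pairDist_sub_le_Bsq (M M' : 𝓜) (ω : SelSpace d n 𝓜) :
    pairDist ρ M M' ω - lam1 d n 𝓜 ρ M' ≤ Bsq d n 𝓜 ρ M ω := by
  refine le_csSup (𝓜.finite_toSet.image _).bddAbove ⟨M', M'.2, ?_⟩
  simp only [selEstN_coe, pairDist]

lemma Bsq_le (M : 𝓜) (ω : SelSpace d n 𝓜) {b : ℝ}
    (h : ∀ M' : 𝓜, pairDist ρ M M' ω - lam1 d n 𝓜 ρ M' ≤ b) : Bsq d n 𝓜 ρ M ω ≤ b := by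
  refine csSup_le (Set.Nonempty.image _ ⟨M, M.2⟩) ?_
  rintro _ ⟨M', hM', rfl⟩
  have := h ⟨M', hM'⟩
  simp only [pairDist, ← selEstN_coe] at this
  exact this

lemma lam1_eq (hρ : 0 < ρ) (M : ℕ) :
    lam1 d n 𝓜 ρ M = 96 * ((2 * M + 1 : ℕ) : ℝ) ^ d / n
      + 24 * (((2 * M + 1 : ℕ) : ℝ) ^ d * sigmaSel d n 𝓜 ρ M ^ 2) := by
  rw [lam1, sigmaSel_sq hρ, mul_comm 2 d, pow_mul, ← mul_div_assoc, div_div_eq_mul_div]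
  ring

lemma lam2_eq (hρ : 0 < ρ) (M : ℕ) :
    lam2 d n 𝓜 ρ M = 96 * ((2 * M + 1 : ℕ) : ℝ) ^ d / n
      + 28 * (((2 * M + 1 : ℕ) : ℝ) ^ d * sigmaSel d n 𝓜 ρ M ^ 2) := by
  have h := lam1_eq (d := d) (n := n) (𝓜 := 𝓜) hρ M
  rw [lam1] at h
  rw [lam2, lam1]
  simp only [mul_div_assoc] at h ⊢
  linarith

lemma lam1_nonneg (hρ : 0 < ρ) (M : ℕ) : 0 ≤ lam1 d n 𝓜 ρ M := by
  rw [lam1_eq hρ]; positivity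

lemma lam1_le_lam2 (hρ : 0 < ρ) (M : ℕ) : lam1 d n 𝓜 ρ M ≤ lam2 d n 𝓜 ρ M := by
  unfold lam2
  have : 0 ≤ 16 * ((2 * M + 1 : ℕ) : ℝ) ^ (2 * d) / ((n : ℝ) ^ 2 * (ρ / 𝓜.card)) := by positivity
  linarith

/-- Any other estimator is close to the selected one, up to bias estimate and penalty. -/
lemma l2sq_sub_selected_le (hρ : 0 < ρ) {S : 𝓜} {ω : SelSpace d n 𝓜} (M : 𝓜)
    (hS : Bsq d n 𝓜 ρ S ω + lam2 d n 𝓜 ρ S ≤ Bsq d n 𝓜 ρ M ω + lam2 d n 𝓜 ρ M) :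
    l2sq d (fun x => selEst d n 𝓜 ρ M ω x - selEst d n 𝓜 ρ S ω x)
      ≤ 2 * Bsq d n 𝓜 ρ M ω + 4 * lam2 d n 𝓜 ρ M := by
  have hM := pairDist_sub_le_Bsq (ρ := ρ) M M ω
  rw [pairDist_self] at hM
  have l1 := lam1_le_lam2 (d := d) (n := n) (𝓜 := 𝓜) hρ M
  have l2 := lam1_le_lam2 (d := d) (n := n) (𝓜 := 𝓜) hρ S
  have l3 := lam1_nonneg (d := d) (n := n) (𝓜 := 𝓜) hρ S
  have l4 := lam1_nonneg (d := d) (n := n) (𝓜 := 𝓜) hρ M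
  have hSM := pairDist_sub_le_Bsq (ρ := ρ) S M ω
  rcases le_total (M : ℕ) S with h | h
  · rw [l2sq_selEst_sub M S ω h]
    have hMS := pairDist_sub_le_Bsq (ρ := ρ) M S ω
    have : 0 ≤ pairDist ρ S M ω := l2sq_nonneg _
    linarith
  · have e : l2sq d (fun x => selEst d n 𝓜 ρ M ω x - selEst d n 𝓜 ρ S ω x)
        = l2sq d (fun x => selEst d n 𝓜 ρ S ω x - selEst d n 𝓜 ρ M ω x) := by
      unfold l2sq
      simp_rw [norm_sub_rev]
    rw [e, l2sq_selEst_sub S M ω h]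
    linarith

lemma l2sq_sub_selEst_le (hf : MemLp (fun x => (f x : ℂ)) 2 (volume.restrict (cube d))) (M : 𝓜)
    (ω : SelSpace d n 𝓜) :
    l2sq d (fun x => (f x : ℂ) - selEst d n 𝓜 ρ M ω x)
      ≤ 2 * projBias f M + 4 * empError n f (box d M) ω.1 + 4 * noiseError ρ M ω := by
  set P := trigPoly (box d M) fun k => fCoeff d (fun x => (f x : ℂ)) k
    - (empCoeff d n ω.1 k + noiseCoeff ρ M ω k) with hP
  have e : (fun x => (f x : ℂ) - selEst d n 𝓜 ρ M ω x)
      = fun x => ((f x : ℂ) - projM d M (fun y => (f y : ℂ)) x) + P x := by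
    ext x
    simp only [hP, selEst_eq_trigPoly, trigPoly, projM, sub_mul, Finset.sum_sub_distrib]
    ring
  rw [e]
  refine (l2sq_add_le (memLp_sub_projM hf M) (memLp_trigPoly _ _ 2)).trans ?_
  have h : l2sq d P ≤ 2 * empError n f (box d M) ω.1 + 2 * noiseError ρ M ω := by
    rw [hP, l2sq_trigPoly, ← sum_sq_noiseCoeff, empError, Finset.mul_sum, Finset.mul_sum,
      ← Finset.sum_add_distrib]
    refine Finset.sum_le_sum fun k _ => ?_
    have := sq_norm_add_le (empCoeff d n ω.1 k - fCoeff d (fun x => (f x : ℂ)) k)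
      (noiseCoeff ρ M ω k)
    rwa [← norm_neg, show -(empCoeff d n ω.1 k - fCoeff d (fun x => (f x : ℂ)) k
      + noiseCoeff ρ M ω k) = fCoeff d (fun x => (f x : ℂ)) k
        - (empCoeff d n ω.1 k + noiseCoeff ρ M ω k) by ring] at this
  unfold projBias
  linarith

/-- The largest cut-off in `𝓜` whose dimension lies in the `j`-th dyadic block. -/
def blockMax (d : ℕ) (𝓜 : Finset ℕ) (j : ℕ) : ℕ :=
  (𝓜.filter fun M => Nat.log 2 ((2 * M + 1) ^ d) = j).sup id

/-- The dyadic blocks met by the dimensions of the cut-offs in `𝓜`. -/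
def blocks (d : ℕ) (𝓜 : Finset ℕ) : Finset ℕ :=
  𝓜.image fun M => Nat.log 2 ((2 * M + 1) ^ d)

lemma blockMax_mem {j : ℕ} (hj : j ∈ blocks d 𝓜) :
    blockMax d 𝓜 j ∈ 𝓜 ∧ Nat.log 2 ((2 * blockMax d 𝓜 j + 1) ^ d) = j := by
  obtain ⟨M, hM, rfl⟩ := Finset.mem_image.1 hj
  obtain ⟨N, hN, e⟩ := Finset.exists_mem_eq_sup (𝓜.filter fun M' =>
    Nat.log 2 ((2 * M' + 1) ^ d) = Nat.log 2 ((2 * M + 1) ^ d))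
    ⟨M, Finset.mem_filter.2 ⟨hM, rfl⟩⟩ id
  rw [blockMax, e]
  exact Finset.mem_filter.1 hN

lemma le_blockMax {M : ℕ} (hM : M ∈ 𝓜) :
    M ≤ blockMax d 𝓜 (Nat.log 2 ((2 * M + 1) ^ d)) :=
  Finset.le_sup (f := id) (Finset.mem_filter.2 ⟨hM, rfl⟩)

/-- The sum over dyadic blocks of the excesses of the empirical error. -/
def dataExcess (f : (Fin d → ℝ) → ℝ) (𝓜 : Finset ℕ) (X : Fin n → Fin d → ℝ) : ℝ :=
  ∑ j ∈ blocks d 𝓜, max (empError n f (box d (blockMax d 𝓜 j)) X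
    - 12 * (box d (blockMax d 𝓜 j)).card / n) 0

lemma empError_sub_le_dataExcess {M : ℕ} (hM : M ∈ 𝓜) (X : Fin n → Fin d → ℝ) :
    empError n f (box d M) X - 24 * ((2 * M + 1 : ℕ) : ℝ) ^ d / n ≤ dataExcess f 𝓜 X := by
  set j := Nat.log 2 ((2 * M + 1) ^ d) with hj
  have hjm : j ∈ blocks d 𝓜 := Finset.mem_image_of_mem _ hM
  refine le_trans ?_ (Finset.single_le_sum
    (f := fun j => max (empError n f (box d (blockMax d 𝓜 j)) X
      - 12 * (box d (blockMax d 𝓜 j)).card / n) 0) (fun _ _ => le_max_right _ _) hjm)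
  refine le_trans ?_ (le_max_left _ _)
  have h1 : empError n f (box d M) X ≤ empError n f (box d (blockMax d 𝓜 j)) X :=
    Finset.sum_le_sum_of_subset_of_nonneg (box_subset (le_blockMax hM))
      fun _ _ _ => by positivity
  have h2 : (2 * blockMax d 𝓜 j + 1) ^ d ≤ 2 * (2 * M + 1) ^ d := by
    have h3 := Nat.lt_pow_succ_log_self (by norm_num : 1 < 2) ((2 * blockMax d 𝓜 j + 1) ^ d)
    rw [(blockMax_mem hjm).2] at h3
    have h4 := Nat.pow_log_le_self 2 (pow_pos (by omega : 0 < 2 * M + 1) d).ne'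
    rw [← hj] at h4
    rw [pow_succ] at h3
    omega
  have h5 : 12 * ((box d (blockMax d 𝓜 j)).card : ℝ) / n
      ≤ 24 * ((2 * M + 1 : ℕ) : ℝ) ^ d / n := by
    rw [card_box]
    gcongr ?_ / n
    have : (((2 * blockMax d 𝓜 j + 1) ^ d : ℕ) : ℝ) ≤ ((2 * (2 * M + 1) ^ d : ℕ) : ℝ) := by
      exact_mod_cast h2
    rw [Nat.cast_mul, Nat.cast_pow (2 * M + 1)] at this
    push_cast at this ⊢
    linarith
  linarith

lemma sum_half_pow_le (s : Finset ℕ) : ∑ j ∈ s, (1 / 2 : ℝ) ^ j ≤ 2 := by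
  refine (Summable.sum_le_tsum s (fun _ _ => by positivity) summable_geometric_two).trans ?_
  rw [tsum_geometric_two]

lemma IsDensity.integrable_dataExcess (hf : IsDensity d f)
    (hb : eLpNorm (fun x => f x) ⊤ (volume.restrict (cube d)) < ⊤) (hn : 1 ≤ n)
    (h𝓜 : ∀ M ∈ 𝓜, (2 * M + 1) ^ d ≤ n) :
    Integrable (dataExcess (n := n) f 𝓜) (Measure.pi fun _ => densMeasure d f) ∧
    ∫ X, dataExcess (n := n) f 𝓜 X ∂(Measure.pi fun _ => densMeasure d f)
      ≤ 400 * (1 + supNorm d f) ^ 3 / n := by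
  have := hf.isProbabilityMeasure
  have hi : ∀ j ∈ blocks d 𝓜, Integrable (fun X => max (empError n f (box d (blockMax d 𝓜 j)) X
      - 12 * (box d (blockMax d 𝓜 j)).card / n) 0) (Measure.pi fun _ => densMeasure d f) :=
    fun j _ => ((hf.integrable_empError hb hn _).1.sub (integrable_const _)).sup
      (integrable_const 0)
  refine ⟨integrable_finsetSum _ hi, ?_⟩
  have h0 : 0 ≤ supNorm d f := ENNReal.toReal_nonneg
  unfold dataExcess
  rw [integral_finsetSum _ hi]
  calc _ ≤ ∑ j ∈ blocks d 𝓜, (200 * (1 + supNorm d f) ^ 3 / n) * (1 / 2) ^ j := by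
        refine Finset.sum_le_sum fun j hj => ?_
        obtain ⟨h1, h2⟩ := blockMax_mem hj
        have hc := card_box (d := d) (blockMax d 𝓜 j)
        refine (hf.integral_empError_excess_le hb (box d (blockMax d 𝓜 j)) ?_ ?_).trans ?_
        · rw [hc]; exact Nat.one_le_pow _ _ (by omega)
        · rw [hc]; exact h𝓜 _ h1
        · have h3 : 2 ^ j ≤ (box d (blockMax d 𝓜 j)).card := by
            have h5 := Nat.pow_log_le_self 2
              (pow_pos (by omega : 0 < 2 * blockMax d 𝓜 j + 1) d).ne'
            rw [hc]
            rwa [h2] at h5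
          have h4 : (2 : ℝ) ^ j ≤ (box d (blockMax d 𝓜 j)).card := by exact_mod_cast h3
          have hn' : (0 : ℝ) < n := by exact_mod_cast hn
          rw [one_div, inv_pow, ← div_eq_mul_inv, div_div]
          gcongr
    _ ≤ (200 * (1 + supNorm d f) ^ 3 / n) * 2 := by
        rw [← Finset.mul_sum]
        gcongr
        exact sum_half_pow_le _
    _ = _ := by ring

/-- The sum of the excesses of the noise errors. -/
def noiseExcess (ρ : ℝ) (ω : SelSpace d n 𝓜) : ℝ :=
  ∑ M : 𝓜, sigmaSel d n 𝓜 ρ M ^ 2 *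
    max (∑ ν, ‖ω.2 M ν‖ ^ 2 - 6 * Fintype.card (Fin d → Fin (2 * (M : ℕ) + 1))) 0

lemma noiseError_sub_le_noiseExcess (M : 𝓜) (ω : SelSpace d n 𝓜) :
    noiseError ρ M ω - 6 * (((2 * M + 1 : ℕ) : ℝ) ^ d * sigmaSel d n 𝓜 ρ M ^ 2)
      ≤ noiseExcess ρ ω := by
  refine le_trans ?_ (Finset.single_le_sum (f := fun M : 𝓜 => sigmaSel d n 𝓜 ρ M ^ 2 *
    max (∑ ν, ‖ω.2 M ν‖ ^ 2 - 6 * Fintype.card (Fin d → Fin (2 * (M : ℕ) + 1)) : ℝ) 0)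
    (fun _ _ => by positivity) (Finset.mem_univ M))
  have h := mul_le_mul_of_nonneg_left (le_max_left (∑ ν, ‖ω.2 M ν‖ ^ 2
    - 6 * Fintype.card (Fin d → Fin (2 * (M : ℕ) + 1)) : ℝ) 0) (sq_nonneg (sigmaSel d n 𝓜 ρ M))
  refine le_trans (le_of_eq ?_) h
  rw [noiseError]
  simp only [Fintype.card_pi, Fintype.card_fin, Finset.prod_const, Finset.card_univ]
  push_cast
  ring

lemma integral_comp_of_measurePreserving {α β : Type*} [MeasurableSpace α] [MeasurableSpace β]
    {μ : Measure α} {ν : Measure β} {T : α → β} (hT : MeasurePreserving T μ ν) {g : β → ℝ}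
    (hg : Integrable g ν) :
    Integrable (fun x => g (T x)) μ ∧ ∫ x, g (T x) ∂μ = ∫ y, g y ∂ν := by
  refine ⟨hT.integrable_comp_of_integrable hg, ?_⟩
  have hg' := hg.1
  rw [← hT.map_eq] at hg' ⊢
  exact (integral_map hT.measurable.aemeasurable hg').symm

lemma IsDensity.measurePreserving_fst (hf : IsDensity d f) :
    MeasurePreserving Prod.fst (selMeasure d n 𝓜 f) (Measure.pi fun _ => densMeasure d f) := by
  have := hf.isProbabilityMeasure
  exact MeasureTheory.measurePreserving_fst

lemma IsDensity.measurePreserving_noise (hf : IsDensity d f) (M : 𝓜) :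
    MeasurePreserving (fun ω : SelSpace d n 𝓜 => ω.2 M) (selMeasure d n 𝓜 f)
      (Measure.pi fun _ => stdCGauss) := by
  have := hf.isProbabilityMeasure
  exact (measurePreserving_eval (fun M : 𝓜 =>
    Measure.pi fun _ : Fin d → Fin (2 * (M : ℕ) + 1) => stdCGauss) M).comp
    MeasureTheory.measurePreserving_snd

lemma IsDensity.integrable_noiseError (hf : IsDensity d f) (M : 𝓜) :
    Integrable (noiseError ρ M) (selMeasure d n 𝓜 f) ∧
    ∫ ω, noiseError ρ M ω ∂selMeasure d n 𝓜 f
      ≤ 8 * (((2 * M + 1 : ℕ) : ℝ) ^ d * sigmaSel d n 𝓜 ρ M ^ 2) := by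
  obtain ⟨h1, h2⟩ := integral_comp_of_measurePreserving (hf.measurePreserving_noise (n := n) M)
    (integrable_sum_sq_noise _)
  refine ⟨h1.const_mul _, ?_⟩
  unfold noiseError
  rw [integral_const_mul, h2]
  refine (mul_le_mul_of_nonneg_left (integral_sum_sq_noise_le _) (sq_nonneg _)).trans
    (le_of_eq ?_)
  simp only [Fintype.card_pi, Fintype.card_fin, Finset.prod_const, Finset.card_univ]
  push_cast
  ring

lemma IsDensity.integrable_noiseExcess (hf : IsDensity d f) (hd : 1 ≤ d) (hρ : 0 < ρ) :
    Integrable (noiseExcess ρ) (selMeasure d n 𝓜 f) ∧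
    ∫ ω, noiseExcess ρ ω ∂selMeasure d n 𝓜 f ≤ 128 * (𝓜.card / ((n : ℝ) ^ 2 * ρ)) := by
  have key := fun M : 𝓜 => integral_comp_of_measurePreserving
    (hf.measurePreserving_noise (n := n) M)
    (((integrable_sum_sq_noise (Fin d → Fin (2 * (M : ℕ) + 1))).sub (integrable_const
      (6 * Fintype.card (Fin d → Fin (2 * (M : ℕ) + 1)) : ℝ))).sup (integrable_const 0))
  have hi : ∀ M ∈ (Finset.univ : Finset 𝓜), Integrable (fun ω : SelSpace d n 𝓜 =>
      sigmaSel d n 𝓜 ρ M ^ 2 * max (∑ ν, ‖ω.2 M ν‖ ^ 2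
        - 6 * Fintype.card (Fin d → Fin (2 * (M : ℕ) + 1)) : ℝ) 0) (selMeasure d n 𝓜 f) :=
    fun M _ => (key M).1.const_mul _
  refine ⟨integrable_finsetSum _ hi, ?_⟩
  unfold noiseExcess
  rw [integral_finsetSum _ hi]
  refine le_trans (Finset.sum_le_sum (g := fun M : 𝓜 =>
    sigmaSel d n 𝓜 ρ M ^ 2 * (4 * (1 / 2) ^ ((2 * (M : ℕ) + 1) ^ d))) fun M _ => ?_) ?_
  · rw [integral_const_mul]
    gcongr
    refine ((key M).2.trans_le (integral_noise_excess_le _)).trans (le_of_eq ?_)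
    simp
  · rw [Finset.sum_coe_sort 𝓜 fun M =>
      sigmaSel d n 𝓜 ρ M ^ 2 * (4 * (1 / 2 : ℝ) ^ ((2 * M + 1) ^ d))]
    exact sum_sigmaSel_excess_le hd hρ

/-- Deterministic oracle inequality for the selected estimator. -/
lemma l2sq_sub_selected_le_oracle (hρ : 0 < ρ)
    (hf : MemLp (fun x => (f x : ℂ)) 2 (volume.restrict (cube d)))
    {S : 𝓜} {ω : SelSpace d n 𝓜} (M : 𝓜)
    (hS : Bsq d n 𝓜 ρ S ω + lam2 d n 𝓜 ρ S ≤ Bsq d n 𝓜 ρ M ω + lam2 d n 𝓜 ρ M) :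
    l2sq d (fun x => (f x : ℂ) - selEst d n 𝓜 ρ S ω x)
      ≤ (20 * projBias f M + 8 * lam2 d n 𝓜 ρ M) + 8 * empError n f (box d M) ω.1
        + 24 * noiseError ρ M ω + 16 * dataExcess f 𝓜 ω.1 + 16 * noiseExcess ρ ω := by
  have h1 := l2sq_sub_selected_le hρ M hS
  have h2 := l2sq_sub_selEst_le (ρ := ρ) hf M ω
  have h3 : l2sq d (fun x => (f x : ℂ) - selEst d n 𝓜 ρ S ω x)
      ≤ 2 * l2sq d (fun x => (f x : ℂ) - selEst d n 𝓜 ρ M ω x)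
        + 2 * l2sq d (fun x => selEst d n 𝓜 ρ M ω x - selEst d n 𝓜 ρ S ω x) := by
    have := l2sq_add_le (hf.sub (memLp_selEst (ρ := ρ) M ω))
      ((memLp_selEst (ρ := ρ) M ω).sub (memLp_selEst (ρ := ρ) S ω))
    simp only [Pi.sub_apply, sub_add_sub_cancel] at this
    exact this
  have h4 : Bsq d n 𝓜 ρ M ω ≤ 4 * projBias f M + 4 * noiseError ρ M ω
      + 4 * dataExcess f 𝓜 ω.1 + 4 * noiseExcess ρ ω := by
    refine Bsq_le M ω fun M' => ?_
    have g1 := pairDist_le (ρ := ρ) hf M M' ω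
    have g2 := empError_sub_le_dataExcess (f := f) M'.2 ω.1
    have g3 := noiseError_sub_le_noiseExcess (ρ := ρ) M' ω
    rw [lam1_eq hρ]
    have e : 96 * ((2 * M' + 1 : ℕ) : ℝ) ^ d / n = 4 * (24 * ((2 * M' + 1 : ℕ) : ℝ) ^ d / n) := by
      ring
    linarith
  linarith

lemma IsDensity.integral_selected_le (hf : IsDensity d f)
    (hb : eLpNorm (fun x => f x) ⊤ (volume.restrict (cube d)) < ⊤) (hd : 1 ≤ d) (hn : 1 ≤ n)
    (hρ : 0 < ρ) (h𝓜 : ∀ M ∈ 𝓜, (2 * M + 1) ^ d ≤ n) {Msel : SelSpace d n 𝓜 → ℕ}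
    (hsel : IsSelectionRule d n 𝓜 ρ Msel) (M : 𝓜) :
    ∫ ω, l2sq d (fun x => (f x : ℂ) - selEstN d n 𝓜 ρ (Msel ω) ω x) ∂ selMeasure d n 𝓜 f
      ≤ 800 * (projBias f M + ((2 * M + 1 : ℕ) : ℝ) ^ d / n
          + 2 * ((2 * M + 1 : ℕ) : ℝ) ^ d * sigmaSel d n 𝓜 ρ M ^ 2)
        + 6400 * (1 + supNorm d f) ^ 3 / n + 2048 * 𝓜.card / ((n : ℝ) ^ 2 * ρ) := by
  have := hf.isProbabilityMeasure
  have : IsProbabilityMeasure (selMeasure d n 𝓜 f) := by unfold selMeasure; infer_instance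
  obtain ⟨i1, b1⟩ := hf.integrable_empError hb hn (box d M)
  obtain ⟨i1, e1⟩ := integral_comp_of_measurePreserving
    (hf.measurePreserving_fst (n := n) (𝓜 := 𝓜)) i1
  obtain ⟨i2, b2⟩ := hf.integrable_noiseError (n := n) (ρ := ρ) M
  obtain ⟨i3, b3⟩ := hf.integrable_dataExcess hb hn h𝓜
  obtain ⟨i3, e3⟩ := integral_comp_of_measurePreserving
    (hf.measurePreserving_fst (n := n) (𝓜 := 𝓜)) i3
  obtain ⟨i4, b4⟩ := hf.integrable_noiseExcess (n := n) (𝓜 := 𝓜) hd hρ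
  set c := 20 * projBias f M + 8 * lam2 d n 𝓜 ρ M with hc
  have j1 : Integrable (fun ω : SelSpace d n 𝓜 => c + 8 * empError n f (box d M) ω.1)
      (selMeasure d n 𝓜 f) := (integrable_const c).add (i1.const_mul 8)
  have j2 : Integrable (fun ω : SelSpace d n 𝓜 => c + 8 * empError n f (box d M) ω.1
      + 24 * noiseError ρ M ω) (selMeasure d n 𝓜 f) := j1.add (i2.const_mul 24)
  have j3 : Integrable (fun ω : SelSpace d n 𝓜 => c + 8 * empError n f (box d M) ω.1
      + 24 * noiseError ρ M ω + 16 * dataExcess f 𝓜 ω.1) (selMeasure d n 𝓜 f) :=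
    j2.add (i3.const_mul 16)
  calc _ ≤ ∫ ω, (c + 8 * empError n f (box d M) ω.1
        + 24 * noiseError ρ M ω + 16 * dataExcess f 𝓜 ω.1 + 16 * noiseExcess ρ ω)
          ∂ selMeasure d n 𝓜 f := by
        refine integral_mono_of_nonneg (.of_forall fun ω => l2sq_nonneg _)
          (j3.add (i4.const_mul 16)) (.of_forall fun ω => ?_)
        obtain ⟨hS, hmin⟩ := hsel.2 ω
        have := l2sq_sub_selected_le_oracle hρ (hf.memLp_two hb) (S := ⟨Msel ω, hS⟩) (ω := ω) M
          (hmin M M.2)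
        rw [← selEstN_coe] at this
        exact this
    _ = c + 8 * ∫ X, empError n f (box d M) X ∂(Measure.pi fun _ => densMeasure d f)
        + 24 * ∫ ω, noiseError ρ M ω ∂ selMeasure d n 𝓜 f
        + 16 * ∫ X, dataExcess (n := n) f 𝓜 X ∂(Measure.pi fun _ => densMeasure d f)
        + 16 * ∫ ω, noiseExcess ρ ω ∂ selMeasure d n 𝓜 f := by
        rw [integral_add j3 (i4.const_mul 16), integral_add j2 (i3.const_mul 16),
          integral_add j1 (i2.const_mul 24), integral_add (integrable_const c) (i1.const_mul 8)]
        simp only [integral_const_mul, e1, e3, integral_const, probReal_univ, one_smul]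
    _ ≤ _ := by
        have hb0 : 0 ≤ projBias f M := l2sq_nonneg _
        have hs0 : 0 ≤ ((2 * M + 1 : ℕ) : ℝ) ^ d * sigmaSel d n 𝓜 ρ M ^ 2 := by positivity
        rw [hc, lam2_eq hρ]
        rw [card_box, Nat.cast_pow] at b1
        have t1 : 4 * ((2 * M + 1 : ℕ) : ℝ) ^ d / n = 4 * (((2 * M + 1 : ℕ) : ℝ) ^ d / n) := by
          ring
        have t2 : 96 * ((2 * M + 1 : ℕ) : ℝ) ^ d / n = 96 * (((2 * M + 1 : ℕ) : ℝ) ^ d / n) := by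
          ring
        have t3 : 400 * (1 + supNorm d f) ^ 3 / n = 400 * ((1 + supNorm d f) ^ 3 / n) := by ring
        have t4 : 6400 * (1 + supNorm d f) ^ 3 / n = 6400 * ((1 + supNorm d f) ^ 3 / n) := by ring
        have t5 : 2048 * 𝓜.card / ((n : ℝ) ^ 2 * ρ) = 2048 * (𝓜.card / ((n : ℝ) ^ 2 * ρ)) := by
          ring
        rw [t1] at b1
        rw [t3] at b3
        rw [t2, t4, t5]
        linarith

end Selection

/-- oracle inequality for the penalized-bias selection rule.
There are absolute constants `C₁, C₃ > 0` and a quantity `C₂ > 0` depending only on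
`‖f‖_∞` such that for any finite nonempty collection `𝓜` of positive cut-offs with
`(2 max 𝓜 + 1)^d ≤ n` and any bounded density `f`, any measurable argmin `M̂` of
`B²(M) + Λ⁽²⁾(M)` satisfies
`E‖f - f̂_{M̂}‖² ≤ C₁ min_{M∈𝓜} (‖f - f_M‖² + (2M+1)^d/n + 2(2M+1)^d σ_M²)
  + C₂/n + C₃ |𝓜| / (n² ρ)`. -/
theorem stmt10 :
    ∃ C₁ > (0 : ℝ), ∃ C₃ > (0 : ℝ), ∃ C₂ : ℝ → ℝ, (∀ t, 0 < C₂ t) ∧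
      ∀ (d n : ℕ), 1 ≤ d → 1 ≤ n → ∀ ρ : ℝ, 0 < ρ →
        ∀ 𝓜 : Finset ℕ, ∀ h𝓜 : 𝓜.Nonempty, (∀ M ∈ 𝓜, 0 < M) →
          (2 * 𝓜.max' h𝓜 + 1) ^ d ≤ n →
          ∀ f : (Fin d → ℝ) → ℝ, IsDensity d f →
            eLpNorm (fun x => f x) ⊤ (volume.restrict (cube d)) < ⊤ →
            ∀ Msel : SelSpace d n 𝓜 → ℕ, IsSelectionRule d n 𝓜 ρ Msel →
              (∫ ω, l2sq d (fun x => (f x : ℂ) - selEstN d n 𝓜 ρ (Msel ω) ω x)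
                  ∂ selMeasure d n 𝓜 f)
                ≤ C₁ * sInf ((fun M : ℕ =>
                      l2sq d (fun x => (f x : ℂ) - projM d M (fun y => (f y : ℂ)) x)
                        + ((2 * M + 1 : ℕ) : ℝ) ^ d / n
                        + 2 * ((2 * M + 1 : ℕ) : ℝ) ^ d * sigmaSel d n 𝓜 ρ M ^ 2) '' ↑𝓜)
                  + C₂ (supNorm d f) / n
                  + C₃ * 𝓜.card / ((n : ℝ) ^ 2 * ρ) := by
  refine ⟨800, by norm_num, 2048, by norm_num, fun t => 6400 * (1 + |t|) ^ 3,
    fun t => by positivity, ?_⟩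
  intro d n hd hn ρ hρ 𝓜 h𝓜 _ hmax f hf hb Msel hsel
  have h : ∀ M ∈ 𝓜, (2 * M + 1) ^ d ≤ n := fun M hM =>
    (Nat.pow_le_pow_left (by have := 𝓜.le_max' M hM; omega) d).trans hmax
  have hs : |supNorm d f| = supNorm d f := abs_of_nonneg ENNReal.toReal_nonneg
  obtain ⟨M, hM, e⟩ := (h𝓜.to_set.image fun M : ℕ =>
    l2sq d (fun x => (f x : ℂ) - projM d M (fun y => (f y : ℂ)) x)
      + ((2 * M + 1 : ℕ) : ℝ) ^ d / n
      + 2 * ((2 * M + 1 : ℕ) : ℝ) ^ d * sigmaSel d n 𝓜 ρ M ^ 2).csInf_mem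
    (𝓜.finite_toSet.image _)
  rw [← e]
  beta_reduce
  rw [hs]
  exact hf.integral_selected_le hb hd hn hρ h hsel ⟨M, hM⟩

end
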